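/- (Main Theorem) Let τ ≥ ω be a cardinal and let Z and F be C-embedded fibered Z_τ-sets in ℝ^τ × ℝ^τ with respect to the projection π₁ : ℝ^τ × ℝ^τ → ℝ^τ onto the first factor. Let h : Z → F be a homeomorphism such that π₁ ∘ h = π₁|Z. Then there exists a homeomorphism H : ℝ^τ × ℝ^τ → ℝ^τ × ℝ^τ such that H|Z = h and π₁ ∘ H = π₁. -/

import Mathlib

open Set Topology

universe u

/-- A subset `U` of a topological space is functionally open (a cozero set). -/
def FunctionallyOpen {X : Type*} [TopologicalSpace X] (U : Set X) : Prop :=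
  ∃ φ : X → ℝ, Continuous φ ∧ U = φ ⁻¹' {(0 : ℝ)}ᶜ

/-- A countable cover by functionally open sets. -/
def IsCFOCover {X : Type*} [TopologicalSpace X] (𝒰 : Set (Set X)) : Prop :=
  𝒰.Countable ∧ (∀ U ∈ 𝒰, FunctionallyOpen U) ∧ ⋃₀ 𝒰 = Set.univ

/-- Two maps are `𝒰`-close if every point's images lie in a common member of `𝒰`. -/
def UClose {X Y : Type*} (𝒰 : Set (Set Y)) (f g : X → Y) : Prop :=
  ∀ x, ∃ U ∈ 𝒰, f x ∈ U ∧ g x ∈ U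

/-- Two sets are functionally separated if some continuous `[0,1]`-valued function
is `0` on the first and `1` on the second. -/
def FunctionallySeparated {X : Type*} [TopologicalSpace X] (P Q : Set X) : Prop :=
  ∃ φ : X → ℝ, Continuous φ ∧ (∀ x, φ x ∈ Set.Icc (0 : ℝ) 1) ∧
    (∀ p ∈ P, φ p = 0) ∧ (∀ q ∈ Q, φ q = 1)

/-- `Z` is a fibered `Z_τ`-set in `X` with respect to `p`: the fiber-preserving maps whose
image is functionally separated from `Z` are dense in the `τ`-limitation topology on the
space of fiber-preserving self-maps of `X`. -/
def FiberedZTauSet {X Y : Type u} [TopologicalSpace X] [TopologicalSpace Y]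
    (τ : Cardinal.{u}) (p : X → Y) (Z : Set X) : Prop :=
  IsClosed Z ∧ ∀ g : X → X, Continuous g → (∀ x, p (g x) = p x) →
    ∀ 𝒞 : Set (Set (Set X)), Cardinal.mk ↥𝒞 < τ → (∀ 𝒰 ∈ 𝒞, IsCFOCover 𝒰) →
      ∃ f : X → X, Continuous f ∧ (∀ x, p (f x) = p x) ∧ (∀ 𝒰 ∈ 𝒞, UClose 𝒰 f g) ∧
        FunctionallySeparated (Set.range f) Z

/-- A subset is C-embedded if every continuous real-valued function on it extends
continuously to the whole space. -/
def CEmbedded {X : Type*} [TopologicalSpace X] (Z : Set X) : Prop :=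
  ∀ φ : ↥Z → ℝ, Continuous φ → ∃ ψ : X → ℝ, Continuous ψ ∧ ∀ z : ↥Z, ψ (z : X) = φ z

/-- A sequence of functions is locally eventually zero. -/
def EvZero {Y E : Type*} [TopologicalSpace Y] [Zero E] (μ : ℕ → Y → E) : Prop :=
  ∀ y, ∃ n, ∀ᶠ y' in 𝓝 y, ∀ m ≥ n, μ m y' = 0

namespace EvZero

theorem comp {Y Y' E : Type*} [TopologicalSpace Y] [TopologicalSpace Y'] [Zero E]
    {μ : ℕ → Y → E} (h : EvZero μ) {g : Y' → Y} (hg : Continuous g) :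
    EvZero (fun i y => μ i (g y)) := by
  intro y
  obtain ⟨n, hn⟩ := h (g y)
  exact ⟨n, hg.continuousAt.eventually hn⟩

theorem of_imp {Y E E' : Type*} [TopologicalSpace Y] [Zero E] [Zero E']
    {μ : ℕ → Y → E} (h : EvZero μ) {ν : ℕ → Y → E'} (hν : ∀ i y, μ i y = 0 → ν i y = 0) :
    EvZero ν := by
  intro y
  obtain ⟨n, hn⟩ := h y
  exact ⟨n, hn.mono fun y' hy' m hm => hν _ _ (hy' m hm)⟩

theorem continuous_tsum {Y E : Type*} [TopologicalSpace Y] [AddCommMonoid E]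
    [TopologicalSpace E] [ContinuousAdd E]
    {μ : ℕ → Y → E} (h : EvZero μ) (hc : ∀ i, Continuous (μ i)) :
    Continuous fun y => ∑' i, μ i y := by
  rw [continuous_iff_continuousAt]
  intro y
  obtain ⟨n, hn⟩ := h y
  have : (fun y => ∑' i, μ i y) =ᶠ[𝓝 y] fun y => ∑ i ∈ Finset.range n, μ i y := by
    filter_upwards [hn] with y' hy'
    exact tsum_eq_sum fun i hi => hy' i (by simpa using hi)
  refine ContinuousAt.congr ?_ this.symm
  exact (continuous_finsetSum _ fun i _ => hc i).continuousAt

theorem summable {Y : Type*} [TopologicalSpace Y]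
    {μ : ℕ → Y → ℝ} (h : EvZero μ) (y : Y) : Summable fun i => μ i y := by
  obtain ⟨n, hn⟩ := h y
  have := hn.self_of_nhds
  exact summable_of_ne_finset_zero (s := Finset.range n) fun i hi => this i (by simpa using hi)

end EvZero

theorem exists_increasing_partition {Y : Type*} [TopologicalSpace Y] [NormalSpace Y]
    [ParacompactSpace Y] [T2Space Y] (O : ℕ → Set Y) (ho : ∀ n, IsOpen (O n)) (hm : Monotone O)
    (hc : ∀ y, ∃ n, y ∈ O n) :
    ∃ η : ℕ → Y → ℝ, (∀ n, Continuous (η n)) ∧ (∀ n y, 0 ≤ η n y ∧ η n y ≤ 1) ∧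
      (∀ n y, η n y ≠ 0 → y ∈ O n) ∧ EvZero (fun n y => 1 - η n y) := by
  obtain ⟨ρ, hρ⟩ := PartitionOfUnity.exists_isSubordinate (s := (univ : Set Y)) isClosed_univ O ho
    (fun y _ => by simpa using hc y)
  refine ⟨fun n y => ∑ k ∈ Finset.range (n + 1), ρ k y, ?_, ?_, ?_, ?_⟩
  · intro n
    exact continuous_finsetSum _ fun i _ => (ρ i).continuous
  · intro n y
    refine ⟨Finset.sum_nonneg fun i _ => ρ.nonneg i y, ?_⟩
    have := ρ.sum_le_one y
    have hfin : (Function.support fun i => ρ i y).Finite := ρ.locallyFinite.point_finite y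
    refine le_trans ?_ this
    rw [finsum_eq_sum_of_support_subset _ (s := (Finset.range (n+1) ∪ hfin.toFinset : Finset ℕ))
      (by intro x hx; simp; right; exact hx)]
    exact Finset.sum_le_sum_of_subset_of_nonneg Finset.subset_union_left fun i _ _ => ρ.nonneg i y
  · intro n y hy
    obtain ⟨k, hk, hk'⟩ := Finset.exists_ne_zero_of_sum_ne_zero hy
    exact hm (by simpa [Nat.lt_succ_iff] using hk : k ≤ n) (hρ k (subset_tsupport _ hk'))
  · intro y
    obtain ⟨U, hU, hfin⟩ := ρ.locallyFinite y
    obtain ⟨n, hn⟩ := hfin.bddAbove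
    refine ⟨n, Filter.eventually_of_mem hU fun y' hy' m hm => ?_⟩
    have h1 := ρ.sum_eq_one (mem_univ y')
    rw [finsum_eq_sum_of_support_subset (s := Finset.range (m + 1))] at h1
    · simp only [h1, sub_self]
    · intro k hk
      have : k ≤ n := hn ⟨y', hk, hy'⟩
      simp; omega

/-- A neighbourhood of the zero section in `Y × (ℕ → ℝ)` contains a locally finite gauge. -/
theorem exists_gauge {Y : Type*} [TopologicalSpace Y] [NormalSpace Y] [ParacompactSpace Y]
    [T2Space Y] (φ : Y × (ℕ → ℝ) → ℝ) (hφ : Continuous φ) (h0 : ∀ y, φ (y, 0) < 1) :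
    ∃ μ : ℕ → Y → ℝ, (∀ n, Continuous (μ n)) ∧ (∀ n y, 0 ≤ μ n y) ∧ EvZero μ ∧
      ∀ y t, (∀ i, μ i y * |t i| < 1) → φ (y, t) < 1 := by
  let O : ℕ → Set Y := fun n =>
    interior {y | ∀ t : ℕ → ℝ, (∀ i < n, |t i| < 1 / ((n : ℝ) + 1)) → φ (y, t) < 1}
  obtain ⟨η, hηc, hη01, hηO, hηev⟩ := exists_increasing_partition O (fun n => isOpen_interior)
    (by
      intro n m hnm
      refine interior_mono fun y hy t ht => hy t fun i hi => (ht i (by omega)).trans_le ?_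
      exact one_div_le_one_div_of_le (by positivity) (by exact_mod_cast Nat.succ_le_succ hnm))
    (by
      intro y
      have hnh : {p : Y × (ℕ → ℝ) | φ p < 1} ∈ 𝓝 (y, (0 : ℕ → ℝ)) :=
        (isOpen_lt hφ continuous_const).mem_nhds (h0 y)
      rw [nhds_prod_eq, Filter.mem_prod_iff] at hnh
      obtain ⟨N, hN, W, hW, hsub⟩ := hnh
      rw [nhds_pi, Filter.mem_pi] at hW
      obtain ⟨I, hI, s, hs, hsW⟩ := hW
      obtain ⟨n1, hn1⟩ := hI.bddAbove
      have : ∃ ε > 0, ∀ i ∈ I, ∀ r : ℝ, |r| < ε → r ∈ s i := by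
        have : ∀ᶠ ε in 𝓝[>] (0:ℝ), ∀ i ∈ I, ∀ r : ℝ, |r| < ε → r ∈ s i := by
          rw [Filter.eventually_all_finite hI]
          intro i _
          obtain ⟨e, he, hes⟩ := Metric.mem_nhds_iff.1 (hs i)
          filter_upwards [Ioo_mem_nhdsGT he] with ε hε r hr
          exact hes (by simpa [Real.dist_eq] using hr.trans hε.2)
        obtain ⟨ε, h1, h2⟩ := (this.and self_mem_nhdsWithin).exists
        exact ⟨ε, h2, h1⟩
      obtain ⟨ε, hε, hεs⟩ := this
      obtain ⟨n2, hn2⟩ := exists_nat_one_div_lt hε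
      refine ⟨max (n1 + 1) n2, mem_interior_iff_mem_nhds.2 (Filter.mem_of_superset hN ?_)⟩
      intro y' hy' t ht
      refine hsub (mk_mem_prod hy' (hsW fun i hi => hεs i hi _ ?_))
      have : i < max (n1 + 1) n2 := lt_max_of_lt_left (Nat.lt_succ_of_le (hn1 hi))
      refine (ht i this).trans (lt_of_le_of_lt ?_ hn2)
      exact one_div_le_one_div_of_le (by positivity) (by push_cast; gcongr; exact le_max_right _ _))
  have hnn : ∀ (m : ℕ) y, 0 ≤ ((m : ℝ) + 2) * (1 - η m y) := fun m y =>
    mul_nonneg (by positivity) (sub_nonneg.2 (hη01 m y).2)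
  have hev : ∀ i, EvZero fun m y => if i ≤ m then ((m : ℝ) + 2) * (1 - η m y) else 0 := by
    intro i
    refine hηev.of_imp fun m y hm => ?_
    simp [hm]
  refine ⟨fun i y => ∑' m, if i ≤ m then ((m : ℝ) + 2) * (1 - η m y) else 0, ?_, ?_, ?_, ?_⟩
  · intro i
    refine (hev i).continuous_tsum fun m => ?_
    split_ifs
    · exact continuous_const.mul (continuous_const.sub (hηc m))
    · exact continuous_const
  · intro i y
    exact tsum_nonneg fun m => by split_ifs; exacts [hnn m y, le_rfl]
  · intro y
    obtain ⟨n, hn⟩ := hηev y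
    refine ⟨n, hn.mono fun y' hy' i hi => ?_⟩
    have : ∀ m, (if i ≤ m then ((m : ℝ) + 2) * (1 - η m y') else 0) = 0 := by
      intro m
      split_ifs with h
      · have := hy' m (by omega)
        simp only at this
        rw [this, mul_zero]
      · rfl
    simp [this]
  · intro y t ht
    have hex : ∃ n, η n y ≠ 0 := by
      obtain ⟨n, hn⟩ := hηev y
      refine ⟨n, fun h => ?_⟩
      have := hn.self_of_nhds n le_rfl
      simp [h] at this
    classical
    let n := Nat.find hex
    have hyO : y ∈ O n := hηO n y (Nat.find_spec hex)
    refine interior_subset hyO t fun i hi => ?_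
    obtain ⟨k, hk⟩ : ∃ k, n = k + 1 := ⟨n - 1, by omega⟩
    have hηk : η k y = 0 := by
      by_contra h
      exact Nat.find_min hex (m := k) (by omega) h
    have hle : ((k : ℝ) + 2) ≤ ∑' m, if i ≤ m then ((m : ℝ) + 2) * (1 - η m y) else 0 := by
      have := ((hev i).summable y).le_tsum k (fun m _ => by split_ifs; exacts [hnn m y, le_rfl])
      rw [if_pos (by omega), hηk] at this
      simpa using this
    have h1 := ht i
    have h2 : ((k : ℝ) + 2) * |t i| < 1 :=
      lt_of_le_of_lt (mul_le_mul_of_nonneg_right hle (abs_nonneg _)) h1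
    change |t i| < 1 / ((n : ℝ) + 1)
    rw [lt_div_iff₀ (by positivity), hk]
    push_cast
    linarith

/-- Triangular families of homeomorphisms along a well-ordered index set assemble to a
homeomorphism of the product. -/
theorem exists_triangular_homeomorph {I : Type*} [LinearOrder I] [WellFoundedLT I]
    {𝔅 E E' : Type*} [TopologicalSpace 𝔅] [TopologicalSpace E] [TopologicalSpace E'] (e0 : E)
    (T : I → 𝔅 × (I → E) → E → E') (G : I → 𝔅 × (I → E) → E' → E)
    (hT : ∀ i, Continuous fun p : (𝔅 × (I → E)) × E => T i p.1 p.2)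
    (hG : ∀ i, Continuous fun p : (𝔅 × (I → E)) × E' => G i p.1 p.2)
    (hdG : ∀ i b e e', (∀ j < i, e j = e' j) → G i (b, e) = G i (b, e'))
    (hTG : ∀ i q x, T i q (G i q x) = x) (hGT : ∀ i q x, G i q (T i q x) = x) :
    ∃ H : 𝔅 × (I → E) ≃ₜ 𝔅 × (I → E'), ∀ b e, H (b, e) = (b, fun i => T i (b, e) (e i)) := by
  classical
  let inv : 𝔅 → (I → E') → I → E := fun b e' =>
    (wellFounded_lt (α := I)).fix fun i rec =>
      G i (b, fun j => if hj : j < i then rec j hj else e0) (e' i)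
  have hinv : ∀ b e' i, inv b e' i =
      G i (b, fun j => if j < i then inv b e' j else e0) (e' i) := by
    intro b e' i
    have := (wellFounded_lt (α := I)).fix_eq (C := fun _ => E) (fun i rec =>
      G i (b, fun j => if hj : j < i then rec j hj else e0) (e' i)) i
    refine this.trans ?_
    congr 2
  have hinv' : ∀ b e' i, inv b e' i = G i (b, inv b e') (e' i) := by
    intro b e' i
    rw [hinv]
    rw [hdG i b _ (inv b e')]
    intro j hj
    simp [hj]
  have hinvc : ∀ i, Continuous fun p : 𝔅 × (I → E') => inv p.1 p.2 i := by
    intro i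
    induction i using (wellFounded_lt (α := I)).induction with
    | _ i ih =>
      have : (fun p : 𝔅 × (I → E') => inv p.1 p.2 i) = fun p =>
          G i (p.1, fun j => if j < i then inv p.1 p.2 j else e0) (p.2 i) :=
        funext fun p => hinv _ _ _
      rw [this]
      refine (hG i).comp (Continuous.prodMk (continuous_fst.prodMk (continuous_pi fun j => ?_))
        ((continuous_apply i).comp continuous_snd))
      split_ifs with hj
      · exact ih j hj
      · exact continuous_const
  refine ⟨{ toFun := fun p => (p.1, fun i => T i p (p.2 i))
            invFun := fun p => (p.1, inv p.1 p.2)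
            left_inv := ?_
            right_inv := ?_
            continuous_toFun := ?_
            continuous_invFun := ?_ }, fun b e => rfl⟩
  · rintro ⟨b, e⟩
    refine Prod.ext rfl (funext fun i => ?_)
    change inv b (fun i => T i (b, e) (e i)) i = e i
    induction i using (wellFounded_lt (α := I)).induction with
    | _ i ih =>
      rw [hinv', hdG i b _ e ih, hGT]
  · rintro ⟨b, e'⟩
    refine Prod.ext rfl (funext fun i => ?_)
    change T i (b, inv b e') (inv b e' i) = e' i
    rw [hinv' b e' i, hTG]
  · exact continuous_fst.prodMk (continuous_pi fun i =>
      (hT i).comp (continuous_id.prodMk ((continuous_apply i).comp continuous_snd)))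
  · exact continuous_fst.prodMk (continuous_pi fun i => hinvc i)

/-- Logarithmic size coordinates of a block. -/
noncomputable def logSize (s : ℕ → ℝ) (e : (ℕ → ℝ) × (ℕ → ℝ)) (n : ℕ) : ℝ :=
  Real.log (max (Real.exp (-e.2 n)) |e.1 n - s n|)

/-- Block coordinates with respect to a centre `s` and a scale function `l`. -/
noncomputable def blockFwd (s : ℕ → ℝ) (l : (ℕ → ℝ) → ℝ) (e : (ℕ → ℝ) × (ℕ → ℝ)) :
    ℝ × ((ℕ → ℝ) × (ℕ → ℝ)) :=
  (logSize s e 0 + l (fun n => logSize s e (n + 1) - logSize s e 0),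
    (fun n => logSize s e (n + 1) - logSize s e 0), fun n => (e.1 n - s n) * Real.exp (e.2 n))

/-- Size coordinates recovered from block coordinates. -/
noncomputable def blockSize (l : (ℕ → ℝ) → ℝ) (y : ℝ × ((ℕ → ℝ) × (ℕ → ℝ))) (n : ℕ) : ℝ :=
  Nat.casesOn n (y.1 - l y.2.1) fun m => y.2.1 m + (y.1 - l y.2.1)

/-- The inverse of `blockFwd`. -/
noncomputable def blockInv (s : ℕ → ℝ) (l : (ℕ → ℝ) → ℝ) (y : ℝ × ((ℕ → ℝ) × (ℕ → ℝ))) :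
    (ℕ → ℝ) × (ℕ → ℝ) :=
  (fun n => s n + Real.exp (blockSize l y n) * (y.2.2 n / max |y.2.2 n| 1),
    fun n => -blockSize l y n + Real.log (max |y.2.2 n| 1))

theorem logSize_pos_arg (s : ℕ → ℝ) (e : (ℕ → ℝ) × (ℕ → ℝ)) (n : ℕ) :
    0 < max (Real.exp (-e.2 n)) |e.1 n - s n| := lt_max_of_lt_left (Real.exp_pos _)

theorem exp_logSize (s : ℕ → ℝ) (e : (ℕ → ℝ) × (ℕ → ℝ)) (n : ℕ) :
    Real.exp (logSize s e n) = max (Real.exp (-e.2 n)) |e.1 n - s n| :=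
  Real.exp_log (logSize_pos_arg s e n)

theorem blockSize_blockFwd (s : ℕ → ℝ) (l : (ℕ → ℝ) → ℝ) (e : (ℕ → ℝ) × (ℕ → ℝ)) :
    blockSize l (blockFwd s l e) = logSize s e := by
  funext n
  cases n <;> simp [blockSize, blockFwd]

theorem blockInv_blockFwd (s : ℕ → ℝ) (l : (ℕ → ℝ) → ℝ) (e : (ℕ → ℝ) × (ℕ → ℝ)) :
    blockInv s l (blockFwd s l e) = e := by
  have key : ∀ n, max |(e.1 n - s n) * Real.exp (e.2 n)| 1 =
      Real.exp (e.2 n) * Real.exp (logSize s e n) := by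
    intro n
    rw [exp_logSize, mul_max_of_nonneg _ _ (Real.exp_pos _).le, ← Real.exp_add, abs_mul,
      abs_of_pos (Real.exp_pos _), max_comm]
    simp [mul_comm]
  unfold blockInv
  rw [blockSize_blockFwd]
  simp only [blockFwd, key]
  refine Prod.ext (funext fun n => ?_) (funext fun n => ?_)
  · have h1 := (Real.exp_pos (e.2 n)).ne'
    have h2 := (Real.exp_pos (logSize s e n)).ne'
    simp only
    field_simp
    ring
  · simp only [← Real.exp_add, Real.log_exp]
    ring

theorem logSize_blockInv (s : ℕ → ℝ) (l : (ℕ → ℝ) → ℝ) (y : ℝ × ((ℕ → ℝ) × (ℕ → ℝ))) :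
    logSize s (blockInv s l y) = blockSize l y := by
  funext n
  have hM : 0 < max |y.2.2 n| 1 := lt_max_of_lt_right one_pos
  unfold logSize
  rw [← Real.log_exp (blockSize l y n)]
  congr 1
  simp only [blockInv, add_sub_cancel_left, neg_add, neg_neg, abs_mul, abs_div, Real.exp_add,
    Real.exp_neg, Real.exp_log hM, abs_of_pos (Real.exp_pos _), abs_of_pos hM]
  rw [div_eq_inv_mul, ← mul_max_of_nonneg _ _ (Real.exp_pos _).le]
  conv_lhs => rw [← mul_one (max |y.2.2 n| 1)⁻¹, mul_assoc, one_mul,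
    ← mul_max_of_nonneg _ _ (inv_nonneg.2 hM.le)]
  rw [max_comm 1, inv_mul_cancel₀ hM.ne', mul_one]

theorem blockFwd_blockInv (s : ℕ → ℝ) (l : (ℕ → ℝ) → ℝ) (y : ℝ × ((ℕ → ℝ) × (ℕ → ℝ))) :
    blockFwd s l (blockInv s l y) = y := by
  have hz : (fun n => logSize s (blockInv s l y) (n + 1) - logSize s (blockInv s l y) 0) =
      y.2.1 := by
    funext n
    rw [logSize_blockInv]
    simp [blockSize]
  unfold blockFwd
  rw [hz, logSize_blockInv]
  refine Prod.ext (by simp [blockSize]) (Prod.ext rfl (funext fun n => ?_))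
  have hM : 0 < max |y.2.2 n| 1 := lt_max_of_lt_right one_pos
  simp only [blockInv, Real.exp_add, Real.exp_neg, Real.exp_log hM, add_sub_cancel_left]
  have := (Real.exp_pos (blockSize l y n)).ne'
  field_simp

theorem continuous_logSize {Y : Type*} [TopologicalSpace Y] {s : Y → ℕ → ℝ}
    {e : Y → (ℕ → ℝ) × (ℕ → ℝ)} (hs : Continuous s) (he : Continuous e) (n : ℕ) :
    Continuous fun y => logSize (s y) (e y) n := by
  unfold logSize
  refine Continuous.log ?_ fun y => (logSize_pos_arg _ _ _).ne'
  fun_prop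

/-- The scale function of a block. -/
noncomputable def blockScale (μ : ℕ → ℝ) (z : ℕ → ℝ) : ℝ :=
  2 + Real.log (1 + μ 0 + ∑' n, μ (n + 1) * Real.exp (z n))

theorem continuous_blockScale {Y : Type*} [TopologicalSpace Y] {μ : ℕ → Y → ℝ}
    (hμ : ∀ n, Continuous (μ n)) (h0 : ∀ n y, 0 ≤ μ n y) (hev : EvZero μ)
    {z : Y → ℕ → ℝ} (hz : Continuous z) :
    Continuous fun y => blockScale (fun n => μ n y) (z y) := by
  unfold blockScale
  refine continuous_const.add (Continuous.log ?_ fun y => ?_)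
  · refine (continuous_const.add (hμ 0)).add (EvZero.continuous_tsum
      (μ := fun n y => μ (n + 1) y * Real.exp (z y n)) ?_ fun n => ?_)
    · intro y
      obtain ⟨n, hn⟩ := hev y
      exact ⟨n, hn.mono fun y' hy' m hm => by simp only [hy' (m + 1) (by omega), zero_mul]⟩
    · have := hμ (n + 1)
      fun_prop
  · have : 0 ≤ ∑' n, μ (n + 1) y * Real.exp (z y n) :=
      tsum_nonneg fun n => mul_nonneg (h0 _ _) (Real.exp_pos _).le
    have := h0 0 y
    positivity

theorem two_le_blockFwd {μ : ℕ → ℝ} (h0 : ∀ n, 0 ≤ μ n) (hev : ∃ n, ∀ m ≥ n, μ m = 0)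
    (s : ℕ → ℝ) (e : (ℕ → ℝ) × (ℕ → ℝ)) (h : ∃ n, 1 ≤ μ n * |e.1 n - s n|) :
    2 ≤ (blockFwd s (blockScale μ) e).1 := by
  obtain ⟨n, hn⟩ := h
  have hx : |e.1 n - s n| ≤ Real.exp (logSize s e n) := by
    rw [exp_logSize]; exact le_max_right _ _
  have hn' : 1 ≤ μ n * Real.exp (logSize s e n) := hn.trans (mul_le_mul_of_nonneg_left hx (h0 n))
  have hnn : ∀ m, 0 ≤ μ (m + 1) * Real.exp (logSize s e (m + 1) - logSize s e 0) := fun m =>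
    mul_nonneg (h0 _) (Real.exp_pos _).le
  have hsum : Summable fun m => μ (m + 1) * Real.exp (logSize s e (m + 1) - logSize s e 0) := by
    obtain ⟨k, hk⟩ := hev
    refine summable_of_ne_finset_zero (s := Finset.range k) fun i hi => ?_
    rw [hk _ (by simp at hi; omega), zero_mul]
  have hts : 0 ≤ ∑' m, μ (m + 1) * Real.exp (logSize s e (m + 1) - logSize s e 0) :=
    tsum_nonneg hnn
  have hpos : 0 < 1 + μ 0 + ∑' m, μ (m + 1) * Real.exp (logSize s e (m + 1) - logSize s e 0) := by
    have := h0 0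
    positivity
  have key : 1 ≤ Real.exp (logSize s e 0) *
      (1 + μ 0 + ∑' m, μ (m + 1) * Real.exp (logSize s e (m + 1) - logSize s e 0)) := by
    have he := Real.exp_pos (logSize s e 0)
    refine hn'.trans ?_
    rw [mul_comm (μ n)]
    cases n with
    | zero => exact mul_le_mul_of_nonneg_left (by linarith) he.le
    | succ m =>
      have h1 := hsum.le_tsum m fun i _ => hnn i
      rw [Real.exp_sub] at h1
      have h2 := h0 0
      calc _ = Real.exp (logSize s e 0) *
              (μ (m + 1) * (Real.exp (logSize s e (m + 1)) / Real.exp (logSize s e 0))) := by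
            field_simp
        _ ≤ _ := mul_le_mul_of_nonneg_left (by linarith) he.le
  have := Real.log_nonneg key
  rw [Real.log_mul (Real.exp_pos _).ne' hpos.ne', Real.log_exp] at this
  simp only [blockFwd, blockScale]
  linarith

theorem exists_deficiency_coords {I : Type*} [LinearOrder I] [WellFoundedLT I]
    {𝔅 : Type*} [TopologicalSpace 𝔅] (Z : Set (𝔅 × (I → (ℕ → ℝ) × (ℕ → ℝ))))
    (σ : I → 𝔅 × (I → (ℕ → ℝ) × (ℕ → ℝ)) → ℕ → ℝ)
    (μ : I → ℕ → 𝔅 × (I → (ℕ → ℝ) × (ℕ → ℝ)) → ℝ)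
    (hσ : ∀ i, Continuous (σ i)) (hμ : ∀ i n, Continuous (μ i n)) (h0 : ∀ i n x, 0 ≤ μ i n x)
    (hev : ∀ i, EvZero (μ i))
    (hdσ : ∀ i b e e', (∀ j < i, e j = e' j) → σ i (b, e) = σ i (b, e'))
    (hdμ : ∀ i n b e e', (∀ j < i, e j = e' j) → μ i n (b, e) = μ i n (b, e'))
    (hZ : ∀ x ∈ Z, ∀ i, ∃ n, 1 ≤ μ i n x * |(x.2 i).1 n - σ i x n|) :
    ∃ H : 𝔅 × (I → (ℕ → ℝ) × (ℕ → ℝ)) ≃ₜ 𝔅 × (I → ℝ × ((ℕ → ℝ) × (ℕ → ℝ))),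
      (∀ x, (H x).1 = x.1) ∧ ∀ x ∈ Z, ∀ i, 2 ≤ ((H x).2 i).1 := by
  have hT : ∀ i, Continuous fun p : (𝔅 × (I → (ℕ → ℝ) × (ℕ → ℝ))) × ((ℕ → ℝ) × (ℕ → ℝ)) =>
      blockFwd (σ i p.1) (blockScale fun n => μ i n p.1) p.2 := by
    intro i
    have hs : Continuous fun p : (𝔅 × (I → (ℕ → ℝ) × (ℕ → ℝ))) × ((ℕ → ℝ) × (ℕ → ℝ)) => σ i p.1 :=
      (hσ i).comp continuous_fst
    have hl := fun n => continuous_logSize hs continuous_snd n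
    have hz := continuous_pi fun n => (hl (n + 1)).sub (hl 0)
    refine ((hl 0).add (continuous_blockScale (fun n => (hμ i n).comp continuous_fst)
      (fun n y => h0 i n y.1) ((hev i).comp continuous_fst) hz)).prodMk (hz.prodMk ?_)
    fun_prop
  have hG : ∀ i, Continuous fun p : (𝔅 × (I → (ℕ → ℝ) × (ℕ → ℝ))) × (ℝ × ((ℕ → ℝ) × (ℕ → ℝ))) =>
      blockInv (σ i p.1) (blockScale fun n => μ i n p.1) p.2 := by
    intro i
    have hs : Continuous
        fun p : (𝔅 × (I → (ℕ → ℝ) × (ℕ → ℝ))) × (ℝ × ((ℕ → ℝ) × (ℕ → ℝ))) => σ i p.1 :=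
      (hσ i).comp continuous_fst
    have hb : Continuous fun p : (𝔅 × (I → (ℕ → ℝ) × (ℕ → ℝ))) × (ℝ × ((ℕ → ℝ) × (ℕ → ℝ))) =>
        p.2.1 - blockScale (fun n => μ i n p.1) p.2.2.1 := by
      refine Continuous.sub (by fun_prop) (continuous_blockScale
        (fun n => (hμ i n).comp continuous_fst)
        (fun n y => h0 i n y.1) ((hev i).comp continuous_fst) (by fun_prop))
    have hx : ∀ n, Continuous fun p : (𝔅 × (I → (ℕ → ℝ) × (ℕ → ℝ))) × (ℝ × ((ℕ → ℝ) × (ℕ → ℝ))) =>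
        blockSize (blockScale fun n => μ i n p.1) p.2 n := by
      intro n
      cases n with
      | zero => exact hb
      | succ m => exact Continuous.add (by fun_prop) hb
    have hM : ∀ r : ℝ, max |r| 1 ≠ 0 := fun r => (lt_max_of_lt_right one_pos).ne'
    refine Continuous.prodMk (continuous_pi fun n => ?_) (continuous_pi fun n => ?_)
    · refine Continuous.add (by fun_prop) ((Real.continuous_exp.comp (hx n)).mul ?_)
      exact Continuous.div (by fun_prop) (by fun_prop) fun p => hM _
    · refine (hx n).neg.add (Continuous.log (by fun_prop) fun p => hM _)
  have hd : ∀ i b e e', (∀ j < i, e j = e' j) →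
      blockInv (σ i (b, e)) (blockScale fun n => μ i n (b, e)) =
      blockInv (σ i (b, e')) (blockScale fun n => μ i n (b, e')) := by
    intro i b e e' h
    simp only [hdσ i b e e' h, fun n => hdμ i n b e e' h]
  obtain ⟨H, hH⟩ := exists_triangular_homeomorph (I := I) (𝔅 := 𝔅) (0 : (ℕ → ℝ) × (ℕ → ℝ))
    (fun i q => blockFwd (σ i q) (blockScale fun n => μ i n q))
    (fun i q => blockInv (σ i q) (blockScale fun n => μ i n q)) hT hG hd
    (fun i q x => blockFwd_blockInv _ _ _) (fun i q x => blockInv_blockFwd _ _ _)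
  refine ⟨H, fun x => by rw [← Prod.mk.eta (p := x), hH], fun x hx i => ?_⟩
  rw [← Prod.mk.eta (p := x), hH]
  refine two_le_blockFwd (fun n => h0 i n x) ?_ _ _ (hZ x hx i)
  obtain ⟨n, hn⟩ := hev i x
  exact ⟨n, hn.self_of_nhds⟩

/-- First coordinate of the bending homeomorphism of the plane. -/
noncomputable def bendP (r x : ℝ) : ℝ :=
  max x 0 + max r 0 / (2 * max 1 (max r 0 + max (-x) 0)) + max (-1) (min r 0) * (1 + max x 0)
    + (min r (-1) + 1)

/-- Second coordinate of the bending homeomorphism of the plane. -/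
noncomputable def bendQ (r x : ℝ) : ℝ :=
  max r 0 + max (-x) 0 + max (-1) (min r 0) * (1 + max x 0)

/-- First coordinate of the inverse of the bending homeomorphism. -/
noncomputable def unbendR (p q : ℝ) : ℝ :=
  min (max q 0) (2 * max p 0 * max q 1) + min (min (max p (-1)) q) 0 / (1 + max (max p (-1) - q) 0)
    + (p - max p (-1))

/-- Second coordinate of the inverse of the bending homeomorphism. -/
noncomputable def unbendX (p q : ℝ) : ℝ :=
  (max p (-1) - q) + (min (max q 0) (2 * max p 0 * max q 1) - max q 0
    + max (max p 0 - max q 0 / (2 * max q 1)) 0) - (max p 0 - max q 0)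

theorem continuous_bendP : Continuous fun y : ℝ × ℝ => bendP y.1 y.2 := by
  unfold bendP
  have : ∀ y : ℝ × ℝ, 2 * max 1 (max y.1 0 + max (-y.2) 0) ≠ 0 := fun y =>
    (mul_pos two_pos (lt_max_of_lt_left one_pos)).ne'
  fun_prop (disch := exact this)

theorem continuous_bendQ : Continuous fun y : ℝ × ℝ => bendQ y.1 y.2 := by
  unfold bendQ
  fun_prop

theorem continuous_unbendR : Continuous fun y : ℝ × ℝ => unbendR y.1 y.2 := by
  unfold unbendR
  have : ∀ y : ℝ × ℝ, 1 + max (max y.1 (-1) - y.2) 0 ≠ 0 := fun y =>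
    (add_pos_of_pos_of_nonneg one_pos (le_max_right _ _)).ne'
  fun_prop (disch := exact this)

theorem continuous_unbendX : Continuous fun y : ℝ × ℝ => unbendX y.1 y.2 := by
  unfold unbendX
  have : ∀ y : ℝ × ℝ, 2 * max y.2 1 ≠ 0 := fun y =>
    (mul_pos two_pos (lt_max_of_lt_right one_pos)).ne'
  fun_prop (disch := exact this)

theorem bend_of_nonneg {r : ℝ} (hr : 0 ≤ r) (x : ℝ) :
    bendP r x = max x 0 + r / (2 * max 1 (r + max (-x) 0)) ∧ bendQ r x = r + max (-x) 0 := by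
  have h1 : max r 0 = r := max_eq_left hr
  have h2 : max (-1 : ℝ) (min r 0) = 0 := by rw [min_eq_right hr]; norm_num
  have h3 : min r (-1) = -1 := min_eq_right (by linarith)
  constructor
  · rw [bendP, h1, h2, h3]; ring
  · rw [bendQ, h1, h2]; ring

theorem bend_of_mem {r : ℝ} (hr : r ≤ 0) (hr' : -1 ≤ r) (x : ℝ) :
    bendP r x = r * (1 + max x 0) + max x 0 ∧ bendQ r x = r * (1 + max x 0) + max (-x) 0 := by
  have h1 : max r 0 = 0 := max_eq_right hr
  have h2 : max (-1 : ℝ) (min r 0) = r := by rw [min_eq_left hr]; exact max_eq_right hr'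
  have h3 : min r (-1) = -1 := min_eq_right (by linarith)
  constructor
  · rw [bendP, h1, h2, h3]; ring
  · rw [bendQ, h1, h2]; ring

theorem bend_of_le {r : ℝ} (hr : r ≤ -1) (x : ℝ) : bendP r x = r ∧ bendQ r x = -1 - x := by
  have h1 : max r 0 = 0 := max_eq_right (by linarith)
  have h2 : max (-1 : ℝ) (min r 0) = -1 := by
    rw [min_eq_left (by linarith)]; exact max_eq_left hr
  have h3 : min r (-1) = r := min_eq_left (by linarith)
  have h4 : max (-x) 0 - max x 0 = -x := by
    rcases le_total x 0 with h | h
    · rw [max_eq_right h, max_eq_left (by linarith)]; ring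
    · rw [max_eq_left h, max_eq_right (by linarith)]; ring
  constructor
  · rw [bendP, h1, h2, h3]; simp
  · rw [bendQ, h1, h2]; linarith

theorem unbend_of_nonneg {p q : ℝ} (hp : 0 ≤ p) (hq : 0 ≤ q) :
    unbendR p q = min q (2 * p * max q 1) ∧
    unbendX p q = min q (2 * p * max q 1) - q + max (p - q / (2 * max q 1)) 0 := by
  have h1 : max p (-1) = p := max_eq_left (by linarith)
  have h2 : max p 0 = p := max_eq_left hp
  have h3 : max q 0 = q := max_eq_left hq
  have h4 : min (min p q) 0 = 0 := min_eq_right (le_min hp hq)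
  constructor
  · rw [unbendR, h1, h2, h3, h4]; simp
  · rw [unbendX, h1, h2, h3]; ring

theorem unbend_aux {p q : ℝ} (h : min p q ≤ 0) :
    min (max q 0) (2 * max p 0 * max q 1) = 0 ∧
    max (max p 0 - max q 0 / (2 * max q 1)) 0 = max p 0 := by
  have hq1 : 0 < max q 1 := lt_max_of_lt_right one_pos
  rcases min_le_iff.1 h with h | h
  · rw [max_eq_right h, mul_zero, zero_mul]
    refine ⟨min_eq_right (le_max_right _ _), max_eq_right ?_⟩
    have : 0 ≤ max q 0 / (2 * max q 1) := div_nonneg (le_max_right _ _) (by positivity)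
    linarith
  · rw [max_eq_right h, zero_div, sub_zero]
    have : 0 ≤ max p 0 := le_max_right _ _
    exact ⟨min_eq_left (by positivity), max_eq_left this⟩

theorem unbend_of_mem {p q : ℝ} (hp : -1 ≤ p) (h : min p q ≤ 0) :
    unbendR p q = min p q / (1 + max (p - q) 0) ∧ unbendX p q = p - q := by
  obtain ⟨h1, h2⟩ := unbend_aux h
  have h3 : max p (-1) = p := max_eq_left hp
  constructor
  · rw [unbendR, h1, h3, min_eq_left h]; ring
  · rw [unbendX, h1, h2, h3]; ring

theorem unbend_of_le {p : ℝ} (hp : p ≤ -1) (q : ℝ) :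
    unbendR p q = p ∧ unbendX p q = -1 - q := by
  obtain ⟨h1, h2⟩ := unbend_aux (p := p) (q := q) (min_le_iff.2 (Or.inl (by linarith)))
  have h3 : max p (-1) = -1 := max_eq_right hp
  constructor
  · rw [unbendR, h1, h3]
    have : min (min (-1) q) 0 / (1 + max (-1 - q) 0) = -1 := by
      rcases le_total q (-1) with hq | hq
      · rw [min_eq_right hq, min_eq_left (by linarith), max_eq_left (by linarith)]
        rcases eq_or_lt_of_le hq with rfl | hq
        · norm_num
        · rw [div_eq_iff (by linarith)]; ring
      · rw [min_eq_left hq, min_eq_left (by norm_num), max_eq_right (by linarith)]; norm_num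
    rw [this]; ring
  · rw [unbendX, h1, h2, h3]; ring

theorem unbend_bend (r x : ℝ) :
    unbendR (bendP r x) (bendQ r x) = r ∧ unbendX (bendP r x) (bendQ r x) = x := by
  rcases le_total 0 r with hr | hr
  · obtain ⟨hP, hQ⟩ := bend_of_nonneg hr x
    have hq : 0 ≤ bendQ r x := by rw [hQ]; positivity
    have hp : 0 ≤ bendP r x := by rw [hP]; positivity
    obtain ⟨hR, hX⟩ := unbend_of_nonneg hp hq
    rw [hR, hX]
    have hM : 0 < max (bendQ r x) 1 := lt_max_of_lt_right one_pos
    rw [max_comm 1, ← hQ] at hP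
    generalize bendP r x = p at *
    generalize bendQ r x = q at *
    rcases le_total 0 x with hx | hx
    · rw [max_eq_left hx] at hP
      rw [max_eq_right (by linarith : -x ≤ 0), add_zero] at hQ
      subst hQ
      have h1 : min q (2 * p * max q 1) = q := by
        refine min_eq_left ?_
        rw [hP]
        have : 2 * (x + q / (2 * max q 1)) * max q 1 = 2 * x * max q 1 + q := by field_simp
        rw [this]
        have : 0 ≤ 2 * x * max q 1 := by positivity
        linarith
      refine ⟨h1, ?_⟩
      rw [h1, hP, add_sub_cancel_right, max_eq_left hx]; ring
    · rw [max_eq_right hx, zero_add] at hP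
      rw [max_eq_left (by linarith : 0 ≤ -x)] at hQ
      have h1 : 2 * p * max q 1 = r := by rw [hP]; field_simp
      have h2 : min q r = r := min_eq_right (by linarith)
      have h3 : max (p - q / (2 * max q 1)) 0 = 0 := by
        refine max_eq_right ?_
        rw [hP, ← sub_div]
        exact div_nonpos_of_nonpos_of_nonneg (by linarith) (by positivity)
      rw [h1, h2, h3]
      exact ⟨rfl, by linarith⟩
  · rcases le_total (-1) r with hr' | hr'
    · obtain ⟨hP, hQ⟩ := bend_of_mem hr hr' x
      have hd : bendP r x - bendQ r x = x := by
        rw [hP, hQ]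
        rcases le_total x 0 with h | h
        · rw [max_eq_right h, max_eq_left (by linarith)]; ring
        · rw [max_eq_left h, max_eq_right (by linarith)]; ring
      have hm : min (bendP r x) (bendQ r x) = r * (1 + max x 0) := by
        rw [hP, hQ, min_add_add_left]
        rcases le_total x 0 with h | h
        · rw [max_eq_right h, max_eq_left (by linarith), min_eq_left (by linarith)]; ring
        · rw [max_eq_left h, max_eq_right (by linarith), min_eq_right (by linarith)]; ring
      have hx : 0 < 1 + max x 0 := add_pos_of_pos_of_nonneg one_pos (le_max_right _ _)
      obtain ⟨hR, hX⟩ := unbend_of_mem (p := bendP r x) (q := bendQ r x)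
        (by rw [hP]; nlinarith) (by rw [hm]; exact mul_nonpos_of_nonpos_of_nonneg hr hx.le)
      rw [hR, hX, hm, hd]
      exact ⟨mul_div_cancel_right₀ _ hx.ne', rfl⟩
    · obtain ⟨hP, hQ⟩ := bend_of_le hr' x
      rw [hP, hQ]
      obtain ⟨hR, hX⟩ := unbend_of_le hr' (-1 - x)
      exact ⟨hR, by rw [hX]; ring⟩

theorem bend_unbend (p q : ℝ) :
    bendP (unbendR p q) (unbendX p q) = p ∧ bendQ (unbendR p q) (unbendX p q) = q := by
  by_cases h : 0 ≤ p ∧ 0 ≤ q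
  · obtain ⟨hp, hq⟩ := h
    obtain ⟨hR, hX⟩ := unbend_of_nonneg hp hq
    have hM : 0 < max q 1 := lt_max_of_lt_right one_pos
    have hr : 0 ≤ unbendR p q := by rw [hR]; exact le_min hq (by positivity)
    obtain ⟨hP, hQ⟩ := bend_of_nonneg hr (unbendX p q)
    have key : bendQ (unbendR p q) (unbendX p q) = q ∧
        max (unbendX p q) 0 + unbendR p q / (2 * max q 1) = p := by
      rw [hQ, hR, hX]
      rcases le_total q (2 * p * max q 1) with h | h
      · have : 0 ≤ p - q / (2 * max q 1) := by
          rw [sub_nonneg, div_le_iff₀ (by positivity)]; linarith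
        rw [min_eq_left h, max_eq_left this, sub_self, zero_add, max_eq_left this,
          max_eq_right (by linarith)]
        constructor <;> ring
      · have : p - q / (2 * max q 1) ≤ 0 := by
          rw [sub_nonpos, le_div_iff₀ (by positivity)]; linarith
        rw [min_eq_right h, max_eq_right this, add_zero,
          max_eq_right (show 2 * p * max q 1 - q ≤ 0 by linarith),
          max_eq_left (show 0 ≤ -(2 * p * max q 1 - q) by linarith)]
        constructor
        · ring
        · field_simp; simp
    rw [hQ] at key
    rw [hP, hQ, key.1, max_comm 1]
    exact ⟨key.2, rfl⟩
  · have hm : min p q ≤ 0 := by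
      by_contra hc
      push Not at hc
      exact h ⟨(lt_min_iff.1 hc).1.le, (lt_min_iff.1 hc).2.le⟩
    rcases le_total (-1) p with hp | hp
    · obtain ⟨hR, hX⟩ := unbend_of_mem hp hm
      have hd : 0 < 1 + max (p - q) 0 := add_pos_of_pos_of_nonneg one_pos (le_max_right _ _)
      have h1 : unbendR p q ≤ 0 := by
        rw [hR]; exact div_nonpos_of_nonpos_of_nonneg hm hd.le
      have h2 : -1 ≤ unbendR p q := by
        rw [hR, le_div_iff₀ hd]
        rcases le_total p q with h | h
        · rw [min_eq_left h, max_eq_right (by linarith)]; linarith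
        · rw [min_eq_right h, max_eq_left (by linarith)]; linarith
      obtain ⟨hP, hQ⟩ := bend_of_mem h1 h2 (unbendX p q)
      rw [hP, hQ, hX, hR, div_mul_cancel₀ _ hd.ne']
      rcases le_total p q with h | h
      · rw [min_eq_left h, max_eq_right (by linarith), max_eq_left (by linarith)]
        constructor <;> ring
      · rw [min_eq_right h, max_eq_left (by linarith), max_eq_right (by linarith)]
        constructor <;> ring
    · obtain ⟨hR, hX⟩ := unbend_of_le hp q
      rw [hR, hX]
      obtain ⟨hP, hQ⟩ := bend_of_le hp (-1 - q)
      exact ⟨hP, by rw [hQ]; ring⟩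

theorem bendP_nonneg {r : ℝ} (hr : 0 ≤ r) (x : ℝ) : 0 ≤ bendP r x := by
  rw [(bend_of_nonneg hr x).1]; positivity

theorem neg_one_le_bendP {r : ℝ} (hr : -1 ≤ r) (x : ℝ) : -1 ≤ bendP r x := by
  rcases le_total 0 r with h | h
  · have := bendP_nonneg h x; linarith
  · rw [(bend_of_mem h hr x).1]
    nlinarith [le_max_right x 0]

theorem abs_bendP_sub_le {r r' : ℝ} (hr : 0 ≤ r) (hr' : 0 ≤ r') (x : ℝ) :
    |bendP r x - bendP r' x| ≤ |r - r'| / 2 := by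
  wlog h : r' ≤ r generalizing r r'
  · rw [abs_sub_comm, abs_sub_comm r]; exact this hr' hr (le_of_not_ge h)
  rw [(bend_of_nonneg hr x).1, (bend_of_nonneg hr' x).1, abs_of_nonneg (sub_nonneg.2 h)]
  have hc : 0 ≤ max (-x) 0 := le_max_right _ _
  generalize max (-x) 0 = c at *
  have hM1 : 1 ≤ max 1 (r + c) := le_max_left _ _
  have hM1' : 1 ≤ max 1 (r' + c) := le_max_left _ _
  have hMM : max 1 (r' + c) ≤ max 1 (r + c) := max_le_max_left _ (by linarith)
  have hmono : r' * max 1 (r + c) ≤ r * max 1 (r' + c) := by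
    rw [mul_max_of_nonneg _ _ hr, mul_max_of_nonneg _ _ hr']
    exact max_le_max (by linarith) (by nlinarith)
  rw [add_sub_add_left_eq_sub, abs_of_nonneg, div_sub_div _ _ (by positivity) (by positivity),
    div_le_div_iff₀ (by positivity) (by positivity)]
  · have : r * (2 * max 1 (r' + c)) - 2 * max 1 (r + c) * r' ≤
        2 * ((r - r') * max 1 (r + c)) := by nlinarith
    have h3 : (r - r') * max 1 (r + c) ≤ (r - r') * (max 1 (r + c) * max 1 (r' + c)) := by
      refine mul_le_mul_of_nonneg_left ?_ (sub_nonneg.2 h)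
      nlinarith
    nlinarith
  · rw [sub_nonneg, div_le_div_iff₀ (by positivity) (by positivity)]
    nlinarith

theorem abs_bendP_sub_le_half {r r' : ℝ} (hr : 0 ≤ r) (hr' : 0 ≤ r') (x : ℝ) :
    |bendP r x - bendP r' x| ≤ 1 / 2 := by
  have key : ∀ r : ℝ, 0 ≤ r → max x 0 ≤ bendP r x ∧ bendP r x ≤ max x 0 + 1 / 2 := by
    intro r hr
    rw [(bend_of_nonneg hr x).1]
    have hM : r ≤ max 1 (r + max (-x) 0) :=
      le_max_of_le_right (by linarith [le_max_right (-x) 0])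
    have hM1 : 1 ≤ max 1 (r + max (-x) 0) := le_max_left _ _
    refine ⟨by linarith [show 0 ≤ r / (2 * max 1 (r + max (-x) 0)) by positivity], ?_⟩
    have : r / (2 * max 1 (r + max (-x) 0)) ≤ 1 / 2 := by
      rw [div_le_div_iff₀ (by positivity) two_pos]; linarith
    linarith
  have h1 := key r hr
  have h2 := key r' hr'
  rw [abs_le]
  constructor <;> linarith

theorem two_le_unbendR {p q : ℝ} (hp : 1 ≤ p) (hq : 2 ≤ q) : 2 ≤ unbendR p q := by
  rw [(unbend_of_nonneg (by linarith : 0 ≤ p) (by linarith : 0 ≤ q)).1]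
  refine le_min hq ?_
  have : q ≤ max q 1 := le_max_left _ _
  nlinarith

theorem neg_one_le_unbendR {p : ℝ} (q : ℝ) (hp : -1 ≤ p) : -1 ≤ unbendR p q := by
  by_contra hc
  push Not at hc
  have := (bend_of_le hc.le (unbendX p q)).1
  rw [(bend_unbend p q).1] at this
  linarith

/-- Truncation of a real number to the unit interval. -/
noncomputable def clampI (t : ℝ) : ℝ := max 0 (min t 1)

theorem clampI_nonneg (t : ℝ) : 0 ≤ clampI t := le_max_left _ _
theorem clampI_le_one (t : ℝ) : clampI t ≤ 1 := max_le zero_le_one (min_le_right _ _)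
theorem continuous_clampI : Continuous clampI := by unfold clampI; fun_prop
theorem clampI_of_nonpos {t : ℝ} (h : t ≤ 0) : clampI t = 0 :=
  max_eq_left ((min_le_left _ _).trans h)
theorem clampI_of_one_le {t : ℝ} (h : 1 ≤ t) : clampI t = 1 := by
  rw [clampI, min_eq_right h]; norm_num
theorem clampI_of_mem {t : ℝ} (h : 0 ≤ t) (h' : t ≤ 1) : clampI t = t := by
  rw [clampI, min_eq_left h', max_eq_right h]

theorem hasSum_half_pow : HasSum (fun j : ℕ => (1 / 2 : ℝ) ^ (j + 1)) 1 := by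
  have := hasSum_geometric_two.mul_left (1 / 2 : ℝ)
  simpa [pow_succ'] using this

/-- The number of unit steps encoded by `S` up to stage `n`. -/
noncomputable def excess (n : ℕ) (S : ℝ) : ℝ :=
  max (S - 1) 0 + ∑ j ∈ Finset.range n, clampI (2 ^ (j + 1) * S - 1)

theorem excess_nonneg (n : ℕ) (S : ℝ) : 0 ≤ excess n S :=
  add_nonneg (le_max_right _ _) (Finset.sum_nonneg fun _ _ => clampI_nonneg _)

theorem excess_succ (n : ℕ) (S : ℝ) :
    excess (n + 1) S = excess n S + clampI (2 ^ (n + 1) * S - 1) := by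
  rw [excess, excess, Finset.sum_range_succ, add_assoc]

theorem continuous_excess (n : ℕ) : Continuous (excess n) := by
  unfold excess
  refine Continuous.add (by fun_prop) (continuous_finsetSum _ fun j _ =>
    continuous_clampI.comp (by fun_prop))

theorem excess_succ_of_pos {n : ℕ} {S : ℝ} (h : 0 < excess n S) :
    excess (n + 1) S = excess n S + 1 := by
  rw [excess_succ, clampI_of_one_le]
  have key : 2 ≤ 2 ^ (n + 1) * S := by
    have h2 : (1 : ℝ) ≤ 2 ^ n := one_le_pow₀ one_le_two
    by_cases hS : 1 ≤ S
    · rw [pow_succ]; nlinarith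
    · rw [excess, max_eq_right (by linarith), zero_add] at h
      obtain ⟨j, hj, hj'⟩ := Finset.exists_ne_zero_of_sum_ne_zero h.ne'
      have hj1 : 0 < 2 ^ (j + 1) * S - 1 := by
        by_contra hc
        exact hj' (clampI_of_nonpos (not_lt.1 hc))
      have hS0 : 0 < S := by
        by_contra hc
        have : (0 : ℝ) < 2 ^ (j + 1) := by positivity
        nlinarith
      have : (2 : ℝ) ^ (j + 1) ≤ 2 ^ n := pow_le_pow_right₀ one_le_two (by simpa using hj)
      rw [pow_succ 2 n]
      nlinarith
  linarith

theorem clampI_excess_succ (n : ℕ) (S : ℝ) :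
    clampI (excess (n + 1) S) = clampI (2 ^ (n + 1) * S - 1) := by
  rcases (excess_nonneg n S).eq_or_lt with h | h
  · rw [excess_succ, ← h, zero_add, clampI_of_mem (clampI_nonneg _) (clampI_le_one _)]
  · have h1 := excess_succ_of_pos h
    have h2 := excess_succ n S
    rw [clampI_of_one_le (by linarith)]
    linarith

theorem hasSum_clampI_excess {S : ℝ} (hS : 0 ≤ S) :
    max (S - 1) 0 + ∑' j : ℕ, (1 / 2 : ℝ) ^ (j + 1) * clampI (excess (j + 1) S) = S := by
  have hterm : ∀ j : ℕ, (1 / 2 : ℝ) ^ (j + 1) * clampI (2 ^ (j + 1) * S - 1) =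
      min S ((1 / 2) ^ j) - min S ((1 / 2) ^ (j + 1)) := by
    intro j
    have hp : (0 : ℝ) < (1 / 2) ^ (j + 1) := by positivity
    have h1 : ((1 / 2 : ℝ)) ^ (j + 1) * 2 ^ (j + 1) = 1 := by
      rw [← mul_pow]; norm_num
    have h2 : ((1 / 2 : ℝ)) ^ j = 2 * (1 / 2) ^ (j + 1) := by rw [pow_succ]; ring
    rw [h2, clampI, mul_max_of_nonneg _ _ hp.le, mul_min_of_nonneg _ _ hp.le, mul_sub, ← mul_assoc,
      h1, one_mul, mul_zero, mul_one]
    generalize (1 / 2 : ℝ) ^ (j + 1) = t at *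
    rcases le_total S t with h | h
    · rw [min_eq_left h, min_eq_left (by linarith), min_eq_left (by linarith),
        max_eq_left (by linarith)]; ring
    · rcases le_total S (2 * t) with h' | h'
      · rw [min_eq_left h', min_eq_right h, min_eq_left (by linarith), max_eq_right (by linarith)]
      · rw [min_eq_right h', min_eq_right h, min_eq_right (by linarith), max_eq_right (by linarith)]
        ring
  have hsum : HasSum (fun j : ℕ => (1 / 2 : ℝ) ^ (j + 1) * clampI (excess (j + 1) S))
      (min S 1) := by
    rw [hasSum_iff_tendsto_nat_of_nonneg fun j => mul_nonneg (by positivity) (clampI_nonneg _)]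
    simp only [clampI_excess_succ, hterm]
    simp only [Finset.sum_range_sub' fun j : ℕ => min S ((1 / 2 : ℝ) ^ j)]
    have h0 : Filter.Tendsto (fun n : ℕ => (1 / 2 : ℝ) ^ n) Filter.atTop (𝓝 0) :=
      tendsto_pow_atTop_nhds_zero_of_lt_one (by norm_num) (by norm_num)
    have := (tendsto_const_nhds (x := min S 1)).sub ((tendsto_const_nhds (x := S)).min h0)
    simpa [min_eq_right hS] using this
  rw [hsum.tsum_eq]
  rcases le_total S 1 with h | h
  · rw [max_eq_right (by linarith), min_eq_left h]; ring
  · rw [max_eq_left (by linarith), min_eq_right h]; ring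

theorem clampI_of_binary {w : ℝ} (hw : 0 ≤ w) {f : ℕ → ℝ} (h0 : ∀ j, 0 ≤ f j) (h1 : ∀ j, f j ≤ 1)
    (hf : ∀ j, 0 < f j → f (j + 1) = 1) (hwf : 0 < w → f 0 = 1) {S : ℝ}
    (hS : S = w + ∑' j : ℕ, (1 / 2 : ℝ) ^ (j + 1) * f j) :
    max (S - 1) 0 = w ∧ ∀ j, clampI (2 ^ (j + 1) * S - 1) = f j := by
  have hlt : ∀ i j, i < j → 0 < f i → f j = 1 := by
    intro i j hij hi
    induction j, hij using Nat.le_induction with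
    | base => exact hf i hi
    | succ j _ ih => exact hf j (by rw [ih]; exact one_pos)
  have hw1 : 0 < w → ∀ j, f j = 1 := by
    intro h j
    cases j with
    | zero => exact hwf h
    | succ j => exact hlt 0 _ (Nat.succ_pos j) (by rw [hwf h]; exact one_pos)
  have hsum : Summable fun j : ℕ => (1 / 2 : ℝ) ^ (j + 1) * f j :=
    Summable.of_nonneg_of_le (fun j => mul_nonneg (by positivity) (h0 j))
      (fun j => mul_le_of_le_one_right (by positivity) (h1 j)) hasSum_half_pow.summable
  have htail : ∀ j : ℕ,
      (∑' i : ℕ, (1 / 2 : ℝ) ^ (i + (j + 1) + 1) * f (i + (j + 1)) ≤ (1 / 2) ^ (j + 1)) ∧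
      (0 < f j → ∑' i : ℕ, (1 / 2 : ℝ) ^ (i + (j + 1) + 1) * f (i + (j + 1)) =
        (1 / 2) ^ (j + 1)) := by
    intro j
    have hs : HasSum (fun i : ℕ => (1 / 2 : ℝ) ^ (i + (j + 1) + 1)) ((1 / 2) ^ (j + 1)) := by
      have := hasSum_half_pow.mul_left ((1 / 2 : ℝ) ^ (j + 1))
      rw [mul_one] at this
      have e : (fun i : ℕ => (1 / 2 : ℝ) ^ (i + (j + 1) + 1)) =
          fun i : ℕ => (1 / 2 : ℝ) ^ (j + 1) * (1 / 2) ^ (i + 1) := by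
        funext i
        rw [← pow_add]; congr 1; omega
      rw [e]
      exact this
    constructor
    · rw [← hs.tsum_eq]
      exact ((summable_nat_add_iff (j + 1)).2 hsum).tsum_le_tsum
        (fun i => mul_le_of_le_one_right (by positivity) (h1 _)) hs.summable
    · intro hj
      rw [← hs.tsum_eq]
      refine tsum_congr fun i => ?_
      rw [hlt j _ (by omega) hj, mul_one]
  have hsplit : ∀ j : ℕ, S = w + ((∑ i ∈ Finset.range j, (1 / 2 : ℝ) ^ (i + 1) * f i) +
      (1 / 2) ^ (j + 1) * f j + ∑' i : ℕ, (1 / 2 : ℝ) ^ (i + (j + 1) + 1) * f (i + (j + 1))) := by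
    intro j
    rw [hS, ← Finset.sum_range_succ, hsum.sum_add_tsum_nat_add]
  constructor
  · rcases hw.eq_or_lt with h | h
    · have : S ≤ 1 := by
        rw [hS, ← h, zero_add]
        refine le_of_le_of_eq ?_ hasSum_half_pow.tsum_eq
        exact hsum.tsum_le_tsum (fun i => mul_le_of_le_one_right (by positivity) (h1 _))
          hasSum_half_pow.summable
      rw [max_eq_right (by linarith), h]
    · have : S = w + 1 := by
        rw [hS]
        congr 1
        refine Eq.trans ?_ hasSum_half_pow.tsum_eq
        exact tsum_congr fun i => by rw [hw1 h, mul_one]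
      rw [this, max_eq_left (by linarith)]; ring
  · intro j
    have hp : (2 : ℝ) ^ (j + 1) * (1 / 2) ^ (j + 1) = 1 := by rw [← mul_pow]; norm_num
    have hp0 : (0 : ℝ) < 2 ^ (j + 1) := by positivity
    have hearly : f j < 1 → w = 0 ∧ ∑ i ∈ Finset.range j, (1 / 2 : ℝ) ^ (i + 1) * f i = 0 := by
      intro hj
      refine ⟨?_, Finset.sum_eq_zero fun i hi => ?_⟩
      · by_contra hc
        exact hj.ne (hw1 (hw.lt_of_ne' hc) j)
      · by_contra hc
        have : f i ≠ 0 := fun h => hc (by rw [h, mul_zero])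
        exact hj.ne (hlt i j (by simpa using hi) ((h0 i).lt_of_ne' this))
    rcases (h0 j).eq_or_lt with h | h
    · obtain ⟨e1, e2⟩ := hearly (by rw [← h]; exact one_pos)
      have hs := hsplit j
      rw [e1, e2, ← h] at hs
      rw [← h]
      refine clampI_of_nonpos ?_
      have := mul_le_mul_of_nonneg_left (htail j).1 hp0.le
      rw [hp] at this
      rw [hs]; linarith
    · have hs := hsplit j
      rw [(htail j).2 h] at hs
      rcases (h1 j).eq_or_lt with h' | h'
      · rw [h']
        refine clampI_of_one_le ?_
        have h3 : 0 ≤ ∑ i ∈ Finset.range j, (1 / 2 : ℝ) ^ (i + 1) * f i :=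
          Finset.sum_nonneg fun i _ => mul_nonneg (by positivity) (h0 i)
        have h4 : 2 * (1 / 2) ^ (j + 1) ≤ S := by rw [hs, h']; linarith
        have := mul_le_mul_of_nonneg_left h4 hp0.le
        linarith
      · obtain ⟨e1, e2⟩ := hearly h'
        rw [e1, e2] at hs
        have : 2 ^ (j + 1) * S - 1 = f j := by
          rw [hs]
          linear_combination (f j + 1) * hp
        rw [this, clampI_of_mem h.le h'.le]

theorem excess_of_steps {v : ℕ → ℝ} (hv : ∀ n, v n ≤ 0 → v (n + 1) = v n - 1)
    (hv' : ∀ n, 0 ≤ v n → -1 ≤ v (n + 1)) {S : ℝ}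
    (hS : S = max (-v 0) 0 + ∑' j : ℕ, (1 / 2 : ℝ) ^ (j + 1) * clampI (-v (j + 1))) (n : ℕ) :
    max (-v n) 0 = excess n S := by
  have hstep : ∀ n, max (-v (n + 1)) 0 = max (-v n) 0 + clampI (-v (n + 1)) := by
    intro n
    rcases le_total (v n) 0 with h | h
    · have := hv n h
      rw [max_eq_left (by linarith), max_eq_left (by linarith), clampI_of_one_le (by linarith)]
      linarith
    · have := hv' n h
      rw [max_eq_right (by linarith : -v n ≤ 0), zero_add]
      rw [clampI, min_eq_left (by linarith), max_comm]
  obtain ⟨h0, h1⟩ := clampI_of_binary (w := max (-v 0) 0) (f := fun j => clampI (-v (j + 1)))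
    (le_max_right _ _) (fun j => clampI_nonneg _) (fun j => clampI_le_one _)
    (by
      intro j hj
      have : v (j + 1) < 0 := by
        by_contra hc
        rw [clampI_of_nonpos (by linarith)] at hj
        exact lt_irrefl _ hj
      exact clampI_of_one_le (by rw [hv _ this.le]; linarith))
    (by
      intro hj
      have : v 0 < 0 := by
        by_contra hc
        rw [max_eq_right (by linarith)] at hj
        exact lt_irrefl _ hj
      exact clampI_of_one_le (by rw [hv _ this.le]; linarith)) hS
  induction n with
  | zero => simp [excess, h0]
  | succ n ih => rw [hstep, ih, excess_succ, h1]

theorem exists_continuous_limit {Y M : Type*} [TopologicalSpace Y] [PseudoMetricSpace M]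
    [CompleteSpace M] (f : ℕ → Y → M) (hf : ∀ k, Continuous (f k)) (C : ℝ)
    (hd : ∀ k y, dist (f k y) (f (k + 1) y) ≤ C * (1 / 2) ^ k) :
    ∃ g : Y → M, Continuous g ∧ (∀ y, Filter.Tendsto (fun k => f k y) Filter.atTop (𝓝 (g y))) ∧
      ∀ k y, dist (f k y) (g y) ≤ 2 * C * (1 / 2) ^ k := by
  have hcau : ∀ y, CauchySeq fun k => f k y := fun y =>
    cauchySeq_of_le_geometric (1 / 2) C (by norm_num) fun k => hd k y
  choose g hg using fun y => cauchySeq_tendsto_of_complete (hcau y)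
  have hb : ∀ k y, dist (f k y) (g y) ≤ 2 * C * (1 / 2) ^ k := by
    intro k y
    have := dist_le_of_le_geometric_of_tendsto (1 / 2) C (by norm_num) (fun k => hd k y) (hg y) k
    refine this.trans (le_of_eq ?_)
    ring
  refine ⟨g, ?_, hg, hb⟩
  have hu : TendstoUniformly f g Filter.atTop := by
    rw [Metric.tendstoUniformly_iff]
    intro ε hε
    have h0 : Filter.Tendsto (fun n : ℕ => 2 * C * (1 / 2 : ℝ) ^ n) Filter.atTop (𝓝 0) := by
      simpa using (tendsto_pow_atTop_nhds_zero_of_lt_one (by norm_num : (0:ℝ) ≤ 1 / 2)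
        (by norm_num)).const_mul (2 * C)
    filter_upwards [h0.eventually (gt_mem_nhds hε)] with k hk y
    rw [dist_comm]
    exact (hb k y).trans_lt hk
  exact hu.continuous (Filter.Eventually.of_forall hf).frequently

/-- Equal, or both nonnegative. -/
def EqOrNonneg (α β : ℝ) : Prop := α = β ∨ (0 ≤ α ∧ 0 ≤ β)

theorem EqOrNonneg.trans {α β γ : ℝ} (h : EqOrNonneg α β) (h' : EqOrNonneg β γ) :
    EqOrNonneg α γ := by
  rcases h with rfl | ⟨h1, h2⟩
  · exact h'
  · rcases h' with rfl | ⟨h3, h4⟩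
    · exact Or.inr ⟨h1, h2⟩
    · exact Or.inr ⟨h1, h4⟩

theorem EqOrNonneg.bendP {α β : ℝ} (h : EqOrNonneg α β) (x : ℝ) :
    EqOrNonneg (1 + bendP α x) (1 + bendP β x) := by
  rcases h with rfl | ⟨h1, h2⟩
  · exact Or.inl rfl
  · have := bendP_nonneg h1 x
    have := bendP_nonneg h2 x
    exact Or.inr ⟨by linarith, by linarith⟩

theorem EqOrNonneg.abs_sub_le {α β : ℝ} (h : EqOrNonneg α β) (x : ℝ) :
    |(1 + _root_.bendP α x) - (1 + _root_.bendP β x)| ≤ 1 / 2 ∧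
    |(1 + _root_.bendP α x) - (1 + _root_.bendP β x)| ≤ |α - β| / 2 := by
  rcases h with rfl | ⟨h1, h2⟩
  · simp
  · rw [add_sub_add_left_eq_sub]
    exact ⟨abs_bendP_sub_le_half h1 h2 x, abs_bendP_sub_le h1 h2 x⟩

theorem EqOrNonneg.max_neg {α β : ℝ} (h : EqOrNonneg α β) : max (-α) 0 = max (-β) 0 := by
  rcases h with rfl | ⟨h1, h2⟩
  · rfl
  · rw [max_eq_right (by linarith), max_eq_right (by linarith)]

/-- Approximations of the states of the bending process by backward iteration. -/
noncomputable def backState : ℕ → ℕ → ℝ × (ℕ → ℝ) → ℝ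
  | 0, n, y => -excess n y.1
  | k + 1, n, y => 1 + bendP (backState k (n + 1) y) (y.2 n)

theorem continuous_backState (k n : ℕ) : Continuous (backState k n) := by
  induction k generalizing n with
  | zero => exact ((continuous_excess n).comp continuous_fst).neg
  | succ k ih =>
    exact continuous_const.add (continuous_bendP.comp ((ih (n + 1)).prodMk
      ((continuous_apply n).comp continuous_snd)))

theorem backState_approx (y : ℝ × (ℕ → ℝ)) (v : ℕ → ℝ)
    (hv : ∀ n, v n = 1 + bendP (v (n + 1)) (y.2 n)) (h0 : ∀ n, EqOrNonneg (-excess n y.1) (v n))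
    (k n : ℕ) : EqOrNonneg (backState k n y) (v n) ∧
      |backState (k + 1) n y - v n| ≤ (1 / 2) ^ (k + 1) := by
  have h1 : ∀ k n, EqOrNonneg (backState k n y) (v n) := by
    intro k
    induction k with
    | zero => exact h0
    | succ k ih =>
      intro n
      rw [hv n]
      exact (ih (n + 1)).bendP _
  refine ⟨h1 k n, ?_⟩
  induction k generalizing n with
  | zero =>
    rw [hv n]
    rw [zero_add, pow_one]
    exact ((h1 0 (n + 1)).abs_sub_le (y.2 n)).1
  | succ k ih =>
    rw [hv n]
    refine ((h1 (k + 1) (n + 1)).abs_sub_le (y.2 n)).2.trans ?_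
    rw [pow_succ]
    have := ih (n + 1)
    linarith

theorem backState_step (y : ℝ × (ℕ → ℝ)) (k n : ℕ) :
    EqOrNonneg (backState k n y) (backState (k + 1) n y) ∧
      |backState (k + 1) n y - backState (k + 2) n y| ≤ (1 / 2) ^ (k + 1) := by
  have h1 : ∀ k n, EqOrNonneg (backState k n y) (backState (k + 1) n y) := by
    intro k
    induction k with
    | zero =>
      intro n
      change EqOrNonneg (-excess n y.1) (1 + bendP (-excess (n + 1) y.1) (y.2 n))
      rcases (excess_nonneg n y.1).eq_or_lt with h | h
      · right
        rw [← h, excess_succ, ← h, zero_add]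
        have := neg_one_le_bendP (neg_le_neg (clampI_le_one (2 ^ (n + 1) * y.1 - 1))) (y.2 n)
        exact ⟨by simp, by linarith⟩
      · left
        rw [excess_succ_of_pos h, (bend_of_le (by linarith) _).1]
        ring
    | succ k ih => exact fun n => (ih (n + 1)).bendP _
  refine ⟨h1 k n, ?_⟩
  induction k generalizing n with
  | zero =>
    rw [zero_add, pow_one]
    exact ((h1 0 (n + 1)).abs_sub_le (y.2 n)).1
  | succ k ih =>
    refine ((h1 (k + 1) (n + 1)).abs_sub_le (y.2 n)).2.trans ?_
    rw [pow_succ]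
    have := ih (n + 1)
    linarith

theorem exists_states : ∃ U : ℕ → ℝ × (ℕ → ℝ) → ℝ, (∀ n, Continuous (U n)) ∧
    (∀ n y, Filter.Tendsto (fun k => backState (k + 1) n y) Filter.atTop (𝓝 (U n y))) ∧
    (∀ n y, U n y = 1 + bendP (U (n + 1) y) (y.2 n)) ∧
    ∀ n y, EqOrNonneg (-excess n y.1) (U n y) := by
  have := fun n => exists_continuous_limit (fun k => backState (k + 1) n)
    (fun k => continuous_backState _ _) (1 / 2) (fun k y => by
      rw [Real.dist_eq]
      refine (backState_step y k n).2.trans (le_of_eq ?_)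
      rw [pow_succ]; ring)
  choose U hUc hUt _ using this
  refine ⟨U, hUc, fun n y => hUt n y, fun n y => ?_, fun n y => ?_⟩
  · have h1 := (Filter.tendsto_add_atTop_iff_nat 1).2 (hUt n y)
    refine tendsto_nhds_unique h1 ?_
    have hc : Continuous fun r => 1 + bendP r (y.2 n) :=
      continuous_const.add (continuous_bendP.comp (continuous_id.prodMk continuous_const))
    exact (hc.tendsto _).comp (hUt (n + 1) y)
  · have hk : ∀ k, EqOrNonneg (-excess n y.1) (backState k n y) := by
      intro k
      induction k with
      | zero => exact Or.inl rfl
      | succ k ih => exact ih.trans (backState_step y k n).1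
    have hcl : IsClosed {β : ℝ | EqOrNonneg (-excess n y.1) β} := by
      have : {β : ℝ | EqOrNonneg (-excess n y.1) β} =
          {-excess n y.1} ∪ {β | 0 ≤ -excess n y.1 ∧ 0 ≤ β} := by
        ext β; simp [EqOrNonneg, eq_comm]
      rw [this]
      exact isClosed_singleton.union (isClosed_const.and isClosed_Ici)
    exact hcl.mem_of_tendsto (hUt n y) (Filter.Eventually.of_forall fun k => hk _)

/-- States of the bending process. -/
noncomputable def foldState (u : ℝ) (a : ℕ → ℝ) : ℕ → ℝ
  | 0 => u
  | n + 1 => unbendR (foldState u a n - 1) (a n)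

theorem continuous_foldState (n : ℕ) : Continuous fun y : ℝ × (ℕ → ℝ) => foldState y.1 y.2 n := by
  induction n with
  | zero => exact continuous_fst
  | succ n ih =>
    exact continuous_unbendR.comp ((ih.sub continuous_const).prodMk
      ((continuous_apply n).comp continuous_snd))

/-- The total amount encoded by the states of the bending process. -/
noncomputable def foldTotal (v : ℕ → ℝ) : ℝ :=
  max (-v 0) 0 + ∑' j : ℕ, (1 / 2 : ℝ) ^ (j + 1) * clampI (-v (j + 1))

theorem foldTotal_nonneg (v : ℕ → ℝ) : 0 ≤ foldTotal v :=
  add_nonneg (le_max_right _ _) (tsum_nonneg fun _ => mul_nonneg (by positivity) (clampI_nonneg _))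

/-- The line times a countable power of the line is homeomorphic to the half-line times that
power, by a homeomorphism which is explicit enough to locate a face. -/
theorem exists_halfline_homeomorph : ∃ W : ℝ × (ℕ → ℝ) ≃ₜ NNReal × (ℕ → ℝ),
    ∀ u a, 2 ≤ u → (∀ n, 2 ≤ a n) → (W (u, a)).1 = 0 := by
  obtain ⟨U, hUc, hUt, hU, hUe⟩ := exists_states
  have hstep : ∀ u a n, foldState u a n = 1 + bendP (foldState u a (n + 1))
      (unbendX (foldState u a n - 1) (a n)) := by
    intro u a n
    have := (bend_unbend (foldState u a n - 1) (a n)).1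
    rw [foldState, this]; ring
  have hle : ∀ u a n, foldState u a n ≤ 0 → foldState u a (n + 1) = foldState u a n - 1 := by
    intro u a n h
    exact (unbend_of_le (by linarith) _).1
  have hge : ∀ u a n, 0 ≤ foldState u a n → -1 ≤ foldState u a (n + 1) := by
    intro u a n h
    exact neg_one_le_unbendR _ (by linarith)
  have hex : ∀ u a n, max (-foldState u a n) 0 = excess n (foldTotal (foldState u a)) :=
    fun u a n => excess_of_steps (hle u a) (hge u a) rfl n
  have hUF : ∀ u a n, U n (foldTotal (foldState u a),
      fun n => unbendX (foldState u a n - 1) (a n)) = foldState u a n := by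
    intro u a n
    refine tendsto_nhds_unique (hUt n _) ?_
    rw [tendsto_iff_dist_tendsto_zero]
    refine squeeze_zero (fun _ => dist_nonneg) (fun k => ?_)
      ((Filter.tendsto_add_atTop_iff_nat 1).2 (tendsto_pow_atTop_nhds_zero_of_lt_one
        (by norm_num : (0:ℝ) ≤ 1 / 2) (by norm_num)))
    refine (backState_approx _ (foldState u a) (hstep u a) (fun n => ?_) k n).2
    simp only [← hex]
    rcases le_total (foldState u a n) 0 with h | h
    · rw [max_eq_left (by linarith)]; left; ring
    · rw [max_eq_right (by linarith)]; right; simpa using h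
  let W : ℝ × (ℕ → ℝ) ≃ₜ NNReal × (ℕ → ℝ) :=
    { toFun := fun y => ((foldTotal (foldState y.1 y.2)).toNNReal,
        fun n => unbendX (foldState y.1 y.2 n - 1) (y.2 n))
      invFun := fun y => (U 0 (y.1, y.2), fun n => bendQ (U (n + 1) (y.1, y.2)) (y.2 n))
      left_inv := by
        rintro ⟨u, a⟩
        simp only [Real.coe_toNNReal _ (foldTotal_nonneg _), hUF]
        refine Prod.ext rfl (funext fun n => ?_)
        exact (bend_unbend (foldState u a n - 1) (a n)).2
      right_inv := by
        rintro ⟨S, x⟩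
        have hfs : ∀ n, foldState (U 0 (S, x)) (fun n => bendQ (U (n + 1) (S, x)) (x n)) n =
            U n (S, x) := by
          intro n
          induction n with
          | zero => rfl
          | succ n ih =>
            rw [foldState, ih, hU n, add_sub_cancel_left]
            exact (unbend_bend _ _).1
        simp only [hfs]
        refine Prod.ext (NNReal.eq ?_) (funext fun n => ?_)
        · rw [Real.coe_toNNReal _ (foldTotal_nonneg _), foldTotal]
          simp only [funext hfs]
          have h1 : ∀ n, max (-U n (S, x)) 0 = excess n S := by
            intro n
            rw [← (hUe n (S, x)).max_neg, neg_neg, max_eq_left (excess_nonneg _ _)]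
          have h2 : ∀ t : ℝ, clampI t = clampI (max t 0) := by
            intro t
            rcases le_total t 0 with h | h
            · rw [max_eq_right h, clampI_of_nonpos h, clampI_of_nonpos le_rfl]
            · rw [max_eq_left h]
          have h3 : ∀ j, clampI (-U (j + 1) (S, x)) = clampI (excess (j + 1) S) := fun j => by
            rw [h2, h1]
          simp only [h3, h1]
          have e0 : excess 0 (S : ℝ) = max ((S : ℝ) - 1) 0 := by simp [excess]
          rw [e0]
          exact hasSum_clampI_excess S.2
        · simp only
          rw [hU n, add_sub_cancel_left]
          exact (unbend_bend _ _).2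
      continuous_toFun := by
        refine Continuous.prodMk (continuous_real_toNNReal.comp ?_) (continuous_pi fun n =>
          continuous_unbendX.comp (((continuous_foldState n).sub continuous_const).prodMk
            ((continuous_apply n).comp continuous_snd)))
        unfold foldTotal
        refine Continuous.add (((continuous_foldState 0).neg).max continuous_const)
          (continuous_tsum (fun j => continuous_const.mul (continuous_clampI.comp
            (continuous_foldState (j + 1)).neg)) hasSum_half_pow.summable fun j y => ?_)
        rw [Real.norm_of_nonneg (mul_nonneg (by positivity) (clampI_nonneg _))]
        exact mul_le_of_le_one_right (by positivity) (clampI_le_one _)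
      continuous_invFun := by
        have hc : Continuous fun y : NNReal × (ℕ → ℝ) => ((y.1 : ℝ), y.2) := by fun_prop
        exact ((hUc 0).comp hc).prodMk (continuous_pi fun n => continuous_bendQ.comp
          (((hUc (n + 1)).comp hc).prodMk ((continuous_apply n).comp continuous_snd))) }
  refine ⟨W, fun u a hu ha => ?_⟩
  have h2 : ∀ n, 2 ≤ foldState u a n := by
    intro n
    induction n with
    | zero => exact hu
    | succ n ih => exact two_le_unbendR (by linarith) (ha n)
  change (foldTotal (foldState u a)).toNNReal = 0
  rw [foldTotal, max_eq_right (by linarith [h2 0])]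
  have : ∀ j, clampI (-foldState u a (j + 1)) = 0 := fun j =>
    clampI_of_nonpos (by linarith [h2 (j + 1)])
  simp [this]

/-- The quadrant of a plane is homeomorphic to a half-plane. -/
noncomputable def minDiffHomeomorph : NNReal × NNReal ≃ₜ NNReal × ℝ where
  toFun y := (min y.1 y.2, (y.1 : ℝ) - y.2)
  invFun y := (y.1 + y.2.toNNReal, y.1 + (-y.2).toNNReal)
  left_inv := by
    rintro ⟨s, t⟩
    rcases le_total s t with h | h
    · have h' : (s : ℝ) ≤ t := h
      refine Prod.ext (NNReal.eq ?_) (NNReal.eq ?_)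
      · simp [h, Real.toNNReal_of_nonpos (sub_nonpos.2 h')]
      · simp [h, h']
    · have h' : (t : ℝ) ≤ s := h
      refine Prod.ext (NNReal.eq ?_) (NNReal.eq ?_)
      · simp [h, h']
      · simp [h, Real.toNNReal_of_nonpos (sub_nonpos.2 h')]
  right_inv := by
    rintro ⟨s, t⟩
    rcases le_total t 0 with h | h
    · refine Prod.ext (NNReal.eq ?_) ?_
      · simp [Real.toNNReal_of_nonpos h]
      · simp [Real.toNNReal_of_nonpos h, h]
    · have h' : -t ≤ 0 := by linarith
      refine Prod.ext (NNReal.eq ?_) ?_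
      · simp [Real.toNNReal_of_nonpos h']
      · simp [Real.toNNReal_of_nonpos h', h]
  continuous_toFun := by fun_prop
  continuous_invFun := by fun_prop

/-- Reindexing of a power of the line. -/
def arrowHomeomorph {ι ι' : Type*} (e : ι ≃ ι') : (ι → ℝ) ≃ₜ (ι' → ℝ) where
  toFun f j := f (e.symm j)
  invFun f i := f (e i)
  left_inv f := by simp
  right_inv f := by simp
  continuous_toFun := by fun_prop
  continuous_invFun := by fun_prop

theorem exists_face_homeomorph : ∃ Ω : (ℕ → ℝ) ≃ₜ ℝ × (ℕ → ℝ),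
    ∀ a, (∀ n, 2 ≤ a n) → (Ω a).1 = 0 := by
  obtain ⟨W, hW⟩ := exists_halfline_homeomorph
  obtain ⟨e⟩ : Nonempty (ℕ ≃ (Unit ⊕ ℕ) ⊕ (Unit ⊕ ℕ)) := inferInstance
  let c1 : (ℕ → ℝ) ≃ₜ ((Unit ⊕ ℕ) ⊕ (Unit ⊕ ℕ) → ℝ) := arrowHomeomorph e
  let c2 : (Unit ⊕ ℕ → ℝ) ≃ₜ ℝ × (ℕ → ℝ) :=
    Homeomorph.sumArrowHomeomorphProdArrow.trans
      ((Homeomorph.funUnique Unit ℝ).prodCongr (Homeomorph.refl _))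
  let c3 : (ℕ → ℝ) ≃ₜ (ℝ × (ℕ → ℝ)) × (ℝ × (ℕ → ℝ)) :=
    (c1.trans Homeomorph.sumArrowHomeomorphProdArrow).trans (c2.prodCongr c2)
  obtain ⟨e'⟩ : Nonempty (ℕ ≃ (Unit ⊕ ℕ) ⊕ ℕ) := inferInstance
  let c4 : (ℝ × (ℕ → ℝ)) × (ℕ → ℝ) ≃ₜ (ℕ → ℝ) :=
    ((c2.symm.prodCongr (Homeomorph.refl _)).trans
      Homeomorph.sumArrowHomeomorphProdArrow.symm).trans
      (arrowHomeomorph e').symm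
  let D : (NNReal × (ℕ → ℝ)) × (NNReal × (ℕ → ℝ)) ≃ₜ ℝ × ((NNReal × (ℕ → ℝ)) × (ℕ → ℝ)) :=
    (Homeomorph.prodProdProdComm _ _ _ _).trans
      ((minDiffHomeomorph.prodCongr (Homeomorph.refl _)).trans
      { toFun := fun y => (y.1.2, ((y.1.1, y.2.1), y.2.2))
        invFun := fun y => ((y.2.1.1, y.1), (y.2.1.2, y.2.2))
        left_inv := fun _ => rfl
        right_inv := fun _ => rfl
        continuous_toFun := by fun_prop
        continuous_invFun := by fun_prop })
  refine ⟨(c3.trans (W.prodCongr W)).trans (D.trans ((Homeomorph.refl ℝ).prodCongr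
    ((W.symm.prodCongr (Homeomorph.refl _)).trans c4))), fun a ha => ?_⟩
  have h1 : (W (c3 a).1).1 = 0 := hW _ _ (ha _) fun n => ha _
  have h2 : (W (c3 a).2).1 = 0 := hW _ _ (ha _) fun n => ha _
  change (((W (c3 a).1).1 : ℝ) - (W (c3 a).2).1) = 0
  rw [h1, h2, sub_self]

/-- Families of pairs are pairs of families. -/
def arrowProdHomeomorph (I M N : Type*) [TopologicalSpace M] [TopologicalSpace N] :
    (I → M × N) ≃ₜ (I → M) × (I → N) where
  toFun f := (fun i => (f i).1, fun i => (f i).2)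
  invFun f i := (f.1 i, f.2 i)
  left_inv _ := rfl
  right_inv _ := rfl
  continuous_toFun := by fun_prop
  continuous_invFun := by fun_prop

/-- Uncurrying a family of sequences indexed by an infinite set and reindexing it. -/
theorem exists_zero_coords {B : Type*} [TopologicalSpace B] {A R I : Type u} [Infinite I]
    (e : I ≃ A) (hR : Cardinal.mk R ≤ Cardinal.mk I) :
    ∃ K : (B × (R → ℝ)) × (I → ℝ × ((ℕ → ℝ) × (ℕ → ℝ))) ≃ₜ (B × (A → ℝ)) × (A → ℝ),
      (∀ x, (K x).1.1 = x.1.1) ∧ ∀ x, (∀ i, 2 ≤ (x.2 i).1) → (K x).2 = 0 := by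
  obtain ⟨Ω, hΩ⟩ := exists_face_homeomorph
  have hI := Cardinal.aleph0_le_mk I
  obtain ⟨e1⟩ : Nonempty (I ≃ I × ℕ) := by
    rw [← Cardinal.lift_mk_eq']
    simp [Cardinal.mul_aleph0_eq hI]
  obtain ⟨e2⟩ : Nonempty (R ⊕ ((I × ℕ) ⊕ (I × (ℕ ⊕ ℕ))) ≃ A) := by
    rw [← Cardinal.eq, ← Cardinal.mk_congr e]
    simp [Cardinal.mul_aleph0_eq hI, Cardinal.add_eq_self hI, Cardinal.add_eq_right hI hR]
  let c1 : (I → ℝ) ≃ₜ (I → ℝ) × (I → (ℕ → ℝ)) :=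
    ((arrowHomeomorph e1).trans Homeomorph.piCurry).trans
      ((Homeomorph.piCongrRight fun _ => Ω).trans (arrowProdHomeomorph _ _ _))
  let c2 : (I → ℝ × ((ℕ → ℝ) × (ℕ → ℝ))) ≃ₜ
      ((I → ℝ) × (I → (ℕ → ℝ))) × (I → ((ℕ → ℝ) × (ℕ → ℝ))) :=
    (arrowProdHomeomorph _ _ _).trans (c1.prodCongr (Homeomorph.refl _))
  let c3 : (I → ((ℕ → ℝ) × (ℕ → ℝ))) ≃ₜ (I × (ℕ ⊕ ℕ) → ℝ) :=
    (Homeomorph.piCongrRight fun _ => Homeomorph.sumArrowHomeomorphProdArrow.symm).trans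
      Homeomorph.piCurry.symm
  let c4 : (R → ℝ) × ((I → (ℕ → ℝ)) × (I → ((ℕ → ℝ) × (ℕ → ℝ)))) ≃ₜ (A → ℝ) :=
    (((Homeomorph.refl _).prodCongr (((Homeomorph.piCurry.symm).prodCongr c3).trans
      Homeomorph.sumArrowHomeomorphProdArrow.symm)).trans
        Homeomorph.sumArrowHomeomorphProdArrow.symm).trans (arrowHomeomorph e2)
  let c5 : (B × (R → ℝ)) × (((I → ℝ) × (I → (ℕ → ℝ))) × (I → ((ℕ → ℝ) × (ℕ → ℝ)))) ≃ₜ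
      (B × ((R → ℝ) × ((I → (ℕ → ℝ)) × (I → ((ℕ → ℝ) × (ℕ → ℝ)))))) × (I → ℝ) :=
    { toFun := fun x => ((x.1.1, (x.1.2, (x.2.1.2, x.2.2))), x.2.1.1)
      invFun := fun x => ((x.1.1, x.1.2.1), ((x.2, x.1.2.2.1), x.1.2.2.2))
      left_inv := fun _ => rfl
      right_inv := fun _ => rfl
      continuous_toFun := by fun_prop
      continuous_invFun := by fun_prop }
  refine ⟨((Homeomorph.refl _).prodCongr c2).trans (c5.trans
    (((Homeomorph.refl B).prodCongr c4).prodCongr (arrowHomeomorph e))), fun x => rfl,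
    fun x hx => ?_⟩
  funext a
  exact hΩ _ fun n => hx _

theorem exists_continuous_extension {X A : Type*} [TopologicalSpace X] {Z : Set X}
    (hZ : CEmbedded Z) (f : Z → A → ℝ) (hf : Continuous f) :
    ∃ g : X → A → ℝ, Continuous g ∧ ∀ z : Z, g z = f z := by
  choose g hg using fun a => hZ (fun z => f z a) ((continuous_apply a).comp hf)
  exact ⟨fun x a => g a x, continuous_pi fun a => (hg a).1, fun z => funext fun a => (hg a).2 z⟩

theorem exists_homeomorph_extension {X B A : Type*} [TopologicalSpace X] [TopologicalSpace B]
    (p : X → B) {Z F : Set X} (hZC : CEmbedded Z) (hFC : CEmbedded F) (h : Z ≃ₜ F)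
    (hfib : ∀ z, p (h z) = p z) (K L : X ≃ₜ (B × (A → ℝ)) × (A → ℝ))
    (hKp : ∀ x, (K x).1.1 = p x) (hLp : ∀ x, (L x).1.1 = p x)
    (hK : ∀ z ∈ Z, (K z).2 = 0) (hL : ∀ z ∈ F, (L z).2 = 0) :
    ∃ H : X ≃ₜ X, (∀ z : Z, H z = h z) ∧ ∀ x, p (H x) = p x := by
  obtain ⟨α, hαc, hα⟩ := exists_continuous_extension hZC (fun z => (L (h z)).1.2)
    (by fun_prop)
  obtain ⟨β, hβc, hβ⟩ := exists_continuous_extension hFC (fun z => (K (h.symm z)).1.2)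
    (by fun_prop)
  let M : (B × (A → ℝ)) × (A → ℝ) ≃ₜ (B × (A → ℝ)) × (A → ℝ) :=
    { toFun := fun x => ((x.1.1, x.2 + α (K.symm (x.1, 0))),
        x.1.2 - β (L.symm ((x.1.1, x.2 + α (K.symm (x.1, 0))), 0)))
      invFun := fun x => ((x.1.1, x.2 + β (L.symm (x.1, 0))),
        x.1.2 - α (K.symm ((x.1.1, x.2 + β (L.symm (x.1, 0))), 0)))
      left_inv := fun x => by simp
      right_inv := fun x => by simp
      continuous_toFun := by fun_prop
      continuous_invFun := by fun_prop }
  refine ⟨(K.trans M).trans L.symm, fun z => ?_, fun x => ?_⟩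
  · have e1 : K.symm ((K z).1, 0) = z := by
      rw [Homeomorph.symm_apply_eq]
      exact Prod.ext rfl (hK z z.2).symm
    have e2 : L.symm ((p z, (L (h z)).1.2), 0) = h z := by
      rw [Homeomorph.symm_apply_eq]
      refine Prod.ext (Prod.ext ?_ rfl) (hL _ (h z).2).symm
      rw [hLp, hfib]
    change L.symm (((K z).1.1, (K z).2 + α (K.symm ((K z).1, 0))), (K z).1.2 -
      β (L.symm (((K z).1.1, (K z).2 + α (K.symm ((K z).1, 0))), 0))) = h z
    rw [e1, hα, hK z z.2, zero_add, hKp, e2, hβ, h.symm_apply_apply, sub_self, e2]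
  · change p (L.symm (M (K x))) = p x
    rw [← hLp, L.apply_symm_apply, ← hKp]
    rfl

/-- Disjoint families of nonempty open boxes in a power of the line are countable. -/
theorem countable_of_disjoint_boxes {J : Type*} (𝒮 : Set (Set (J → ℝ)))
    (hS : ∀ C ∈ 𝒮, C.Nonempty ∧ ∃ (s : Finset J) (u : J → Set ℝ), (∀ a ∈ s, IsOpen (u a)) ∧
      C = (s : Set J).pi u)
    (hd : 𝒮.PairwiseDisjoint id) : 𝒮.Countable := by
  let γ := ProbabilityTheory.gaussianReal 0 1
  let ν := MeasureTheory.Measure.infinitePi fun _ : J => γ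
  have hm : ∀ C : 𝒮, MeasurableSet (C : Set (J → ℝ)) := by
    rintro ⟨C, hC⟩
    obtain ⟨-, s, u, hu, rfl⟩ := hS C hC
    exact MeasurableSet.pi s.countable_toSet fun i hi => (hu i hi).measurableSet
  have hp : ∀ C : 𝒮, 0 < ν (C : Set (J → ℝ)) := by
    rintro ⟨C, hC⟩
    obtain ⟨⟨x, hx⟩, s, u, hu, rfl⟩ := hS C hC
    simp only [ν]
    rw [MeasureTheory.Measure.infinitePi_pi _ fun i hi => (hu i hi).measurableSet]
    refine pos_iff_ne_zero.2 (Finset.prod_ne_zero_iff.2 fun i hi h0 => ?_)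
    exact ((hu i hi).measure_pos MeasureTheory.volume ⟨x i, hx i hi⟩).ne'
      (ProbabilityTheory.gaussianReal_absolutelyContinuous' 0 one_ne_zero h0)
  have := MeasureTheory.Measure.countable_meas_pos_of_disjoint_iUnion (μ := ν) hm
    fun C C' h => hd C.2 C'.2 fun e => h (Subtype.ext e)
  simp only [hp, ofPred_true] at this
  exact countable_coe_iff.1 (countable_univ_iff.1 this)

/-- An open set in a power of the line has a dense open subset depending on countably many
coordinates. -/
theorem exists_dense_cylinder {J : Type*} (U : Set (J → ℝ)) (hU : IsOpen U) :
    ∃ D : Set J, D.Countable ∧ ∃ W ⊆ U, U ⊆ closure W ∧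
      ∀ x y, (∀ j ∈ D, x j = y j) → x ∈ W → y ∈ W := by
  obtain ⟨𝒮, h𝒮⟩ := zorn_subset {𝒮 : Set (Set (J → ℝ)) |
      (∀ C ∈ 𝒮, C ⊆ U ∧ C.Nonempty ∧ ∃ (s : Finset J) (u : J → Set ℝ),
        (∀ a ∈ s, IsOpen (u a)) ∧ C = (s : Set J).pi u) ∧ 𝒮.PairwiseDisjoint id} (by
    intro c hc hch
    refine ⟨⋃₀ c, ⟨?_, ?_⟩, fun s hs => subset_sUnion_of_mem hs⟩
    · rintro C ⟨s, hs, hC⟩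
      exact (hc hs).1 C hC
    · exact (pairwiseDisjoint_sUnion hch.directedOn).2 fun s hs => (hc hs).2)
  have hcount : 𝒮.Countable := countable_of_disjoint_boxes 𝒮 (fun C hC => (h𝒮.prop.1 C hC).2)
    h𝒮.prop.2
  choose! s u hu hC using fun C hC => (h𝒮.prop.1 C hC).2.2
  refine ⟨⋃ C ∈ 𝒮, s C, hcount.biUnion fun C _ => (s C).countable_toSet, ⋃₀ 𝒮,
    sUnion_subset fun C hC => (h𝒮.prop.1 C hC).1, fun x hx => ?_, ?_⟩
  · rw [mem_closure_iff]
    intro O hO hxO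
    obtain ⟨t, v, hv, hvs⟩ := isOpen_pi_iff.1 (hO.inter hU) x ⟨hxO, hx⟩
    by_contra hne
    have hdis : ∀ C ∈ 𝒮, Disjoint ((t : Set J).pi v) C := by
      intro C hC
      rw [disjoint_left]
      exact fun y hy hyC => hne ⟨y, (hvs hy).1, C, hC, hyC⟩
    have hxv : x ∈ (t : Set J).pi v := fun i hi => (hv i hi).2
    have hmem : (t : Set J).pi v ∈ 𝒮 := by
      refine h𝒮.le_of_ge (y := insert ((t : Set J).pi v) 𝒮) ⟨?_, ?_⟩ (subset_insert _ _)
        (mem_insert _ _)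
      · rintro C (rfl | hC)
        · exact ⟨fun y hy => (hvs hy).2, ⟨x, hxv⟩, t, v, fun i hi => (hv i hi).1, rfl⟩
        · exact h𝒮.prop.1 C hC
      · exact h𝒮.prop.2.insert fun C hC _ => hdis C hC
    exact disjoint_left.1 (hdis _ hmem) hxv hxv
  · rintro x y hxy ⟨C, hCm, hx⟩
    refine ⟨C, hCm, ?_⟩
    rw [hC C hCm] at hx ⊢
    intro j hj
    rw [← hxy j (mem_biUnion hCm hj)]
    exact hx j hj

/-- A continuous function on a power of the line depends on countably many coordinates. -/
theorem exists_countable_dependsOn {J : Type*} (φ : (J → ℝ) → ℝ) (hφ : Continuous φ) :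
    ∃ D : Set J, D.Countable ∧ ∀ x y, (∀ j ∈ D, x j = y j) → φ x = φ y := by
  choose D hD W hWU hUW hW using fun r : ℚ =>
    exists_dense_cylinder (φ ⁻¹' Iio (r : ℝ)) (isOpen_Iio.preimage hφ)
  have key : ∀ x y, (∀ j ∈ ⋃ r, D r, x j = y j) → φ y ≤ φ x := by
    intro x y hxy
    by_contra! hlt
    obtain ⟨r, hr1, hr2⟩ := exists_rat_btwn hlt
    have hx : x ∈ closure (W r) := hUW r hr1
    have hy : y ∈ closure (W r) := by
      have hc : Continuous fun z : J → ℝ => z + (y - x) := by fun_prop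
      have := map_mem_closure hc hx (t := W r) fun z hz => hW r z _ (fun j hj => by
        simp [hxy j (mem_iUnion.2 ⟨r, hj⟩)]) hz
      simpa using this
    have : y ∈ φ ⁻¹' Iic (r : ℝ) := closure_minimal
      ((hWU r).trans (preimage_mono Iio_subset_Iic_self)) (isClosed_Iic.preimage hφ) hy
    exact absurd hr2 (not_lt.2 this)
  exact ⟨⋃ r, D r, countable_iUnion hD, fun x y hxy =>
    le_antisymm (key y x fun j hj => (hxy j hj).symm) (key x y hxy)⟩

theorem exists_gauge_of_metrizable {Y : Type*} [TopologicalSpace Y]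
    [TopologicalSpace.MetrizableSpace Y] (φ : Y × (ℕ → ℝ) → ℝ) (hφ : Continuous φ)
    (h0 : ∀ y, φ (y, 0) < 1) :
    ∃ μ : ℕ → Y → ℝ, (∀ n, Continuous (μ n)) ∧ (∀ n y, 0 ≤ μ n y) ∧ EvZero μ ∧
      ∀ y t, (∀ i, μ i y * |t i| < 1) → φ (y, t) < 1 := by
  let _ := TopologicalSpace.metrizableSpaceMetric Y
  exact exists_gauge φ hφ h0

/-- Fiber-preserving maps with image separated from a fibered `Z_τ`-set can be chosen to agree
with a given map on a small set of coordinates. -/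
theorem FiberedZTauSet.exists_agreeing {A : Type u} {τ : Cardinal.{u}}
    (hτ : Cardinal.aleph0 < τ) {Z : Set ((A → ℝ) × (A → ℝ))}
    (hZ : FiberedZTauSet τ Prod.fst Z) (S : Set A) (hS : Cardinal.mk S < τ)
    (g : (A → ℝ) × (A → ℝ) → (A → ℝ) × (A → ℝ)) (hg : Continuous g) (hgp : ∀ x, (g x).1 = x.1) :
    ∃ f : (A → ℝ) × (A → ℝ) → (A → ℝ) × (A → ℝ), Continuous f ∧ (∀ x, (f x).1 = x.1) ∧
      (∀ x, ∀ s ∈ S, (f x).2 s = (g x).2 s) ∧ FunctionallySeparated (range f) Z := by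
  let O : S → ℕ → ℚ → Set ((A → ℝ) × (A → ℝ)) := fun s n q =>
    {x | |x.2 s - q| < 1 / ((n : ℝ) + 1)}
  let 𝒞 : Set (Set (Set ((A → ℝ) × (A → ℝ)))) := range fun p : S × ℕ => range (O p.1 p.2)
  have hcard : Cardinal.mk 𝒞 < τ := by
    refine Cardinal.mk_range_le.trans_lt ?_
    rw [Cardinal.mk_prod]
    simpa using Cardinal.mul_lt_of_lt hτ.le hS hτ
  have hpos : ∀ n : ℕ, (0 : ℝ) < 1 / ((n : ℝ) + 1) := fun n => Nat.one_div_pos_of_nat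
  have hcov : ∀ 𝒰 ∈ 𝒞, IsCFOCover 𝒰 := by
    rintro _ ⟨⟨s, n⟩, rfl⟩
    refine ⟨countable_range _, ?_, ?_⟩
    · rintro _ ⟨q, rfl⟩
      refine ⟨fun x => max (1 / ((n : ℝ) + 1) - |x.2 s - q|) 0, by fun_prop, ?_⟩
      ext x
      simp [O]
    · refine eq_univ_of_forall fun x => ?_
      obtain ⟨q, hq⟩ := exists_rat_near (x.2 s) (hpos n)
      exact ⟨_, ⟨q, rfl⟩, hq⟩
  obtain ⟨f, hf, hfp, hfc, hsep⟩ := hZ.2 g hg hgp 𝒞 hcard hcov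
  refine ⟨f, hf, hfp, fun x s hs => ?_, hsep⟩
  refine eq_of_forall_dist_le fun ε hε => ?_
  obtain ⟨n, hn⟩ := exists_nat_one_div_lt (half_pos hε)
  obtain ⟨_, ⟨q, rfl⟩, h1, h2⟩ := hfc _ ⟨(⟨s, hs⟩, n), rfl⟩ x
  have h1' : |(f x).2 s - q| < 1 / ((n : ℝ) + 1) := h1
  have h2' : |(g x).2 s - q| < 1 / ((n : ℝ) + 1) := h2
  rw [Real.dist_eq]
  rw [abs_lt] at h1' h2'
  rw [abs_le]
  constructor <;> linarith

/-- Infinitely many fresh coordinates, including all those of a given countable set. -/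
theorem exists_fresh_coords {A : Type u} (S D : Set A) (hA : Cardinal.aleph0 < Cardinal.mk A)
    (hS : Cardinal.mk S < Cardinal.mk A) (hD : D.Countable) :
    ∃ c : ℕ ⊕ ℕ → A, Function.Injective c ∧ (∀ k, c k ∉ S) ∧
      ∀ a ∈ D, a ∉ S → ∃ n, c (Sum.inl n) = a := by
  have hSD : Cardinal.mk (S ∪ D : Set A) < Cardinal.mk A :=
    (Cardinal.mk_union_le _ _).trans_lt (Cardinal.add_lt_of_lt hA.le hS
      (hD.le_aleph0.trans_lt hA))
  have hinf : Infinite ((S ∪ D)ᶜ : Set A) := by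
    have : Infinite A := Cardinal.infinite_iff.2 hA.le
    rw [Cardinal.infinite_iff, Cardinal.mk_compl_of_infinite _ hSD]
    exact hA.le
  obtain ⟨t⟩ : Nonempty (ℕ ⊕ ℕ ↪ ((S ∪ D)ᶜ : Set A)) := by
    obtain ⟨e⟩ : Nonempty (ℕ ⊕ ℕ ≃ ℕ) := inferInstance
    exact ⟨e.toEmbedding.trans (Infinite.natEmbedding _)⟩
  have ht : ∀ k, (t k : A) ∉ S ∧ (t k : A) ∉ D := fun k => by
    simpa [not_or] using (t k).2
  let E : Set A := (D \ S) ∪ range fun n => (t (Sum.inl n) : A)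
  have hEc : E.Countable := (hD.mono sdiff_subset).union (countable_range _)
  have hEi : E.Infinite := (infinite_range_of_injective (Subtype.val_injective.comp
    (t.injective.comp Sum.inl_injective))).mono subset_union_right
  have := hEc.to_subtype
  have := hEi.to_subtype
  obtain ⟨e⟩ : Nonempty (ℕ ≃ E) := by
    have := Classical.choice (nonempty_denumerable E)
    exact ⟨(Denumerable.eqv E).symm⟩
  have hne : ∀ m n, (e m : A) ≠ t (Sum.inr n) := by
    intro m n h
    rcases (e m).2 with h' | ⟨k, hk⟩
    · rw [h] at h'
      exact (ht _).2 h'.1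
    · rw [h] at hk
      exact Sum.inl_ne_inr (t.injective (Subtype.ext hk))
  refine ⟨Sum.elim (fun n => (e n : A)) fun n => t (Sum.inr n), ?_, ?_, ?_⟩
  · exact (Subtype.val_injective.comp e.injective).sumElim
      (Subtype.val_injective.comp (t.injective.comp Sum.inr_injective)) hne
  · rintro (n | n)
    · rcases (e n).2 with h' | ⟨k, hk⟩
      · exact h'.2
      · simp only [Sum.elim_inl, ← hk]
        exact (ht _).1
    · exact (ht _).1
  · intro a ha hs
    exact ⟨e.symm ⟨a, Or.inl ⟨ha, hs⟩⟩, by simp⟩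

/-- Fresh coordinates of points of a fibered `Z_τ`-set are far from a map of the old ones. -/
theorem FiberedZTauSet.exists_gauge_coords {A : Type u}
    (hτ : Cardinal.aleph0 < Cardinal.mk A) {Z : Set ((A → ℝ) × (A → ℝ))}
    (hZ : FiberedZTauSet (Cardinal.mk A) Prod.fst Z) (S : Set A)
    (hS : Cardinal.mk S < Cardinal.mk A) :
    ∃ (c : ℕ ⊕ ℕ → A) (σ : (A → ℝ) × (A → ℝ) → ℕ → ℝ) (μ : ℕ → (A → ℝ) × (A → ℝ) → ℝ),
      Function.Injective c ∧ (∀ k, c k ∉ S) ∧ Continuous σ ∧ (∀ n, Continuous (μ n)) ∧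
      (∀ n x, 0 ≤ μ n x) ∧ EvZero μ ∧
      (∀ x y, x.1 = y.1 → (∀ a ∈ S, x.2 a = y.2 a) → σ x = σ y ∧ ∀ n, μ n x = μ n y) ∧
      ∀ z ∈ Z, ∃ n, 1 ≤ μ n z * |z.2 (c (Sum.inl n)) - σ z n| := by
  classical
  let g : (A → ℝ) × (A → ℝ) → (A → ℝ) × (A → ℝ) := fun x =>
    (x.1, fun a => if a ∈ S then x.2 a else 0)
  have hg : Continuous g := by
    refine continuous_fst.prodMk (continuous_pi fun a => ?_)
    by_cases ha : a ∈ S <;> simp only [ha, if_true, if_false] <;> fun_prop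
  obtain ⟨f, hf, hfp, hfa, φ, hφ, -, hφf, hφZ⟩ := hZ.exists_agreeing hτ S hS g hg fun _ => rfl
  obtain ⟨D₀, hD₀, hdep⟩ := exists_countable_dependsOn
    (φ ∘ (Homeomorph.sumArrowHomeomorphProdArrow : (A ⊕ A → ℝ) ≃ₜ (A → ℝ) × (A → ℝ)))
    (hφ.comp (Homeomorph.continuous _))
  let D : Set A := Sum.inl ⁻¹' D₀ ∪ Sum.inr ⁻¹' D₀
  have hD : D.Countable := (hD₀.preimage Sum.inl_injective).union (hD₀.preimage Sum.inr_injective)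
  have hφD : ∀ x y : (A → ℝ) × (A → ℝ), (∀ a ∈ D, x.1 a = y.1 a) → (∀ a ∈ D, x.2 a = y.2 a) →
      φ x = φ y := by
    intro x y h1 h2
    have := hdep (Homeomorph.sumArrowHomeomorphProdArrow.symm x)
      (Homeomorph.sumArrowHomeomorphProdArrow.symm y) (by
        rintro (a | a) ha
        · exact h1 a (Or.inl ha)
        · exact h2 a (Or.inr ha))
    simpa using this
  obtain ⟨c, hcinj, hcS, hcD⟩ := exists_fresh_coords S D hτ hS hD
  have : Countable D := hD.to_subtype
  let ι : A → ℕ := Function.invFun fun n => c (Sum.inl n)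
  have hι : ∀ n, ι (c (Sum.inl n)) = n :=
    Function.leftInverse_invFun (hcinj.comp Sum.inl_injective)
  let ext : (D → ℝ) → A → ℝ := fun m a => if h : a ∈ D then m ⟨a, h⟩ else 0
  have hext : Continuous ext := by
    refine continuous_pi fun a => ?_
    by_cases ha : a ∈ D <;> simp only [ext, ha, dite_true, dite_false] <;> fun_prop
  let Q : ((D → ℝ) × (D → ℝ)) × (ℕ → ℝ) → (A → ℝ) × (A → ℝ) := fun y =>
    (ext y.1.1, fun a => if a ∈ S then ext y.1.2 a else y.2 (ι a))
  have hQ : Continuous Q := by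
    refine Continuous.prodMk (by fun_prop) (continuous_pi fun a => ?_)
    by_cases ha : a ∈ S <;> simp only [ha, if_true, if_false] <;> fun_prop
  obtain ⟨μ, hμc, hμ0, hμev, hμ⟩ := exists_gauge_of_metrizable (Y := ((D → ℝ) × (D → ℝ)) × (ℕ → ℝ))
    (fun p => |φ (Q (p.1.1, p.1.2 + p.2)) - φ (Q p.1)|) (by fun_prop) (fun y => by simp)
  let σ : (A → ℝ) × (A → ℝ) → ℕ → ℝ := fun x n => (f (g x)).2 (c (Sum.inl n))
  have hσ : Continuous σ := by fun_prop
  let P : (A → ℝ) × (A → ℝ) → ((D → ℝ) × (D → ℝ)) × (ℕ → ℝ) := fun x =>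
    ((fun a => x.1 a, fun a => (g x).2 a), σ x)
  have hP : Continuous P := by fun_prop
  refine ⟨c, σ, fun n x => μ n (P x), hcinj, hcS, hσ, fun n => (hμc n).comp hP,
    fun n x => hμ0 n _, hμev.comp hP, ?_, ?_⟩
  · intro x y h1 h2
    have hgg : g x = g y := by
      refine Prod.ext h1 (funext fun a => ?_)
      by_cases ha : a ∈ S
      · simp [g, ha, h2 a ha]
      · simp [g, ha]
    have hσσ : σ x = σ y := by simp only [σ, hgg]
    have hPP : P x = P y := by simp only [P, hgg, hσσ, h1]
    exact ⟨hσσ, fun n => congrArg (μ n) hPP⟩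
  · intro z hz
    by_contra! hlt
    have := hμ (P z) (fun n => z.2 (c (Sum.inl n)) - σ z n) hlt
    have e1 : φ (Q ((P z).1, (P z).2 + fun n => z.2 (c (Sum.inl n)) - σ z n)) = 1 := by
      rw [← hφZ z hz]
      refine hφD _ _ (fun a ha => by simp [Q, ext, P, ha]) fun a ha => ?_
      by_cases haS : a ∈ S
      · simp [Q, ext, P, g, ha, haS]
      · obtain ⟨n, rfl⟩ := hcD a ha haS
        simp [Q, P, haS, hι]
    have e2 : φ (Q (P z)) = 0 := by
      rw [← hφf (f (g z)) ⟨_, rfl⟩]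
      refine hφD _ _ (fun a ha => by simp [Q, ext, P, ha, hfp, g]) fun a ha => ?_
      by_cases haS : a ∈ S
      · simp [Q, ext, P, g, ha, haS, hfa]
      · obtain ⟨n, rfl⟩ := hcD a ha haS
        simp [Q, P, haS, hι, σ]
    simp only [e1, e2] at this
    norm_num at this

/-- Splitting the coordinates of a power of the line into blocks and a remainder. -/
theorem exists_block_homeomorph {A I B : Type*} [TopologicalSpace B] (c : I → ℕ ⊕ ℕ → A)
    (hc : Function.Injective fun p : I × (ℕ ⊕ ℕ) => c p.1 p.2) :
    ∃ Θ : B × (A → ℝ) ≃ₜ (B × (((range fun p : I × (ℕ ⊕ ℕ) => c p.1 p.2)ᶜ : Set A) → ℝ)) ×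
        (I → (ℕ → ℝ) × (ℕ → ℝ)),
      (∀ x, (Θ x).1.1 = x.1) ∧ (∀ x i n, ((Θ x).2 i).1 n = x.2 (c i (Sum.inl n))) ∧
      ∀ x i n, ((Θ x).2 i).2 n = x.2 (c i (Sum.inr n)) := by
  classical
  let E : ((range fun p : I × (ℕ ⊕ ℕ) => c p.1 p.2)ᶜ : Set A) ⊕ (I × (ℕ ⊕ ℕ)) ≃ A :=
    (Equiv.sumComm _ _).trans (((Equiv.ofInjective _ hc).sumCongr (Equiv.refl _)).trans
      (Equiv.Set.sumCompl _))
  let c1 : (A → ℝ) ≃ₜ (((range fun p : I × (ℕ ⊕ ℕ) => c p.1 p.2)ᶜ : Set A) → ℝ) ×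
      (I → (ℕ → ℝ) × (ℕ → ℝ)) :=
    (arrowHomeomorph E.symm).trans (Homeomorph.sumArrowHomeomorphProdArrow.trans
      ((Homeomorph.refl _).prodCongr (Homeomorph.piCurry.trans
        (Homeomorph.piCongrRight fun _ => Homeomorph.sumArrowHomeomorphProdArrow))))
  exact ⟨((Homeomorph.refl B).prodCongr c1).trans (Homeomorph.prodAssoc _ _ _).symm,
    fun x => rfl, fun x i n => rfl, fun x i n => rfl⟩

theorem FiberedZTauSet.exists_zero_coords_of_aleph0_lt {A : Type u}
    (hτ : Cardinal.aleph0 < Cardinal.mk A) {Z : Set ((A → ℝ) × (A → ℝ))}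
    (hZ : FiberedZTauSet (Cardinal.mk A) Prod.fst Z) :
    ∃ K : (A → ℝ) × (A → ℝ) ≃ₜ ((A → ℝ) × (A → ℝ)) × (A → ℝ),
      (∀ x, (K x).1.1 = x.1) ∧ ∀ z ∈ Z, (K z).2 = 0 := by
  have : Infinite A := Cardinal.infinite_iff.2 hτ.le
  have key := fun S hS => hZ.exists_gauge_coords hτ S hS
  choose! c σ μ hcinj hcS hσ hμ hμ0 hμev hdep hgap using key
  let I := (Cardinal.mk A).ord.ToType
  obtain ⟨e⟩ : Nonempty (I ≃ A) := Cardinal.eq.1 (Cardinal.mk_ord_toType _)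
  let C : I → ℕ ⊕ ℕ → A := WellFounded.fix (wellFounded_lt (α := I))
    fun i rec => c (range fun p : Iio i × (ℕ ⊕ ℕ) => rec p.1 p.1.2 p.2)
  let S : I → Set A := fun i => range fun p : Iio i × (ℕ ⊕ ℕ) => C p.1 p.2
  have hC : ∀ i, C i = c (S i) := fun i => WellFounded.fix_eq _ _ _
  have hS : ∀ i, Cardinal.mk (S i) < Cardinal.mk A := by
    intro i
    refine Cardinal.mk_range_le.trans_lt ?_
    have hi : Cardinal.mk (Iio i) < Cardinal.mk A := by
      simpa [I] using Cardinal.mk_Iio_lt i (by simp [I])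
    simpa using Cardinal.mul_lt_of_lt hτ.le hi hτ
  have hmem : ∀ i j k, j < i → C j k ∈ S i := fun i j k hj => ⟨(⟨j, hj⟩, k), rfl⟩
  have hnot : ∀ i k, C i k ∉ S i := fun i k => by
    rw [hC]
    exact hcS (S i) (hS i) k
  have hinj : Function.Injective fun p : I × (ℕ ⊕ ℕ) => C p.1 p.2 := by
    rintro ⟨i, k⟩ ⟨j, l⟩ h
    simp only at h
    rcases lt_trichotomy i j with hij | rfl | hij
    · exact absurd (h ▸ hmem j i k hij) (hnot j l)
    · rw [hC] at h
      rw [hcinj (S i) (hS i) h]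
    · exact absurd (h ▸ hmem i j l hij) (hnot i k)
  obtain ⟨Θ, hΘ0, hΘ1, hΘ2⟩ := exists_block_homeomorph (B := A → ℝ) C hinj
  have hagree : ∀ i b e e', (∀ j < i, e j = e' j) → (Θ.symm (b, e)).1 = (Θ.symm (b, e')).1 ∧
      ∀ a ∈ S i, (Θ.symm (b, e)).2 a = (Θ.symm (b, e')).2 a := by
    intro i b e e' h
    refine ⟨by rw [← hΘ0, ← hΘ0]; simp, ?_⟩
    rintro _ ⟨⟨⟨j, hj⟩, n | n⟩, rfl⟩
    · simp only [← hΘ1, Homeomorph.apply_symm_apply, h j hj]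
    · simp only [← hΘ2, Homeomorph.apply_symm_apply, h j hj]
  obtain ⟨H, hH1, hH2⟩ := exists_deficiency_coords (I := I) (Θ '' Z)
    (fun i w => σ (S i) (Θ.symm w)) (fun i n w => μ (S i) n (Θ.symm w))
    (fun i => (hσ _ (hS i)).comp Θ.symm.continuous)
    (fun i n => (hμ _ (hS i) n).comp Θ.symm.continuous) (fun i n x => hμ0 _ (hS i) _ _)
    (fun i => (hμev _ (hS i)).comp Θ.symm.continuous)
    (fun i b e e' h => (hdep _ (hS i) _ _ (hagree i b e e' h).1 (hagree i b e e' h).2).1)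
    (fun i n b e e' h => (hdep _ (hS i) _ _ (hagree i b e e' h).1 (hagree i b e e' h).2).2 n)
    (by
      rintro _ ⟨z, hz, rfl⟩ i
      obtain ⟨n, hn⟩ := hgap _ (hS i) z hz
      refine ⟨n, ?_⟩
      simp only [Homeomorph.symm_apply_apply]
      rwa [hΘ1, hC])
  have : Infinite I := e.symm.infinite_iff.1 inferInstance
  obtain ⟨K, hK1, hK2⟩ := exists_zero_coords (B := A → ℝ) e (R :=
    ((range fun p : I × (ℕ ⊕ ℕ) => C p.1 p.2)ᶜ : Set A))
    ((Cardinal.mk_set_le _).trans (Cardinal.mk_congr e).ge)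
  refine ⟨(Θ.trans H).trans K, fun x => ?_, fun z hz => hK2 _ fun i => hH2 _ ⟨z, hz, rfl⟩ i⟩
  simp only [Homeomorph.trans_apply, hK1, hH1, hΘ0]

/-- The set `Z` can be avoided by fiber-preserving maps arbitrarily close to the identity, where
closeness is controlled by continuous functions on the square. -/
def SepApprox {X B : Type*} [TopologicalSpace X] (p : X → B) (Z : Set X) : Prop :=
  ∀ δ : X × X → ℝ, Continuous δ → (∀ x, δ (x, x) < 1) →
    ∃ (f : X → X) (φ : X → ℝ), Continuous f ∧ Continuous φ ∧ (∀ x, p (f x) = p x) ∧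
      (∀ x, δ (f x, x) < 1) ∧ (∀ x, φ (f x) = 0) ∧ ∀ z ∈ Z, φ z = 1

theorem IsOpen.functionallyOpen {X : Type*} [TopologicalSpace X]
    [TopologicalSpace.MetrizableSpace X] {U : Set X} (hU : IsOpen U) : FunctionallyOpen U := by
  let _ := TopologicalSpace.metrizableSpaceMetric X
  rcases eq_or_ne U univ with rfl | hne
  · exact ⟨fun _ => 1, continuous_const, by ext; simp⟩
  · refine ⟨fun x => Metric.infDist x Uᶜ, Metric.continuous_infDist_pt _, ?_⟩
    ext x
    have := hU.isClosed_compl.mem_iff_infDist_zero (nonempty_compl.2 hne) (x := x)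
    simp [← this]

theorem FiberedZTauSet.sepApprox {X Y : Type u} [TopologicalSpace X] [TopologicalSpace Y]
    [TopologicalSpace.MetrizableSpace X] [SecondCountableTopology X]
    {τ : Cardinal.{u}} (hτ : Cardinal.aleph0 ≤ τ) {p : X → Y} {Z : Set X}
    (hZ : FiberedZTauSet τ p Z) : SepApprox p Z := by
  intro δ hδ h1
  have hU : ∀ x, ∃ U : Set X, IsOpen U ∧ x ∈ U ∧ ∀ y ∈ U, ∀ z ∈ U, δ (y, z) < 1 := by
    intro x
    have : {y | δ y < 1} ∈ 𝓝 (x, x) := (isOpen_Iio.preimage hδ).mem_nhds (h1 x)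
    rw [nhds_prod_eq, Filter.mem_prod_self_iff] at this
    obtain ⟨t, ht, hts⟩ := this
    obtain ⟨U, hUt, hU, hx⟩ := mem_nhds_iff.1 ht
    exact ⟨U, hU, hx, fun y hy z hz => hts (mk_mem_prod (hUt hy) (hUt hz))⟩
  choose U hUo hUx hUδ using hU
  obtain ⟨s, hs, hcov⟩ := TopologicalSpace.countable_cover_nhds fun x =>
    (hUo x).mem_nhds (hUx x)
  obtain ⟨f, hf, hfp, hfc, φ, hφ, -, hφ0, hφ1⟩ := hZ.2 id continuous_id (fun _ => rfl) {U '' s}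
    (by rw [Cardinal.mk_singleton]; exact Cardinal.one_lt_aleph0.trans_le hτ) (by
      rintro _ rfl
      refine ⟨hs.image _, ?_, by rw [sUnion_image, hcov]⟩
      rintro _ ⟨x, -, rfl⟩
      exact (hUo x).functionallyOpen)
  refine ⟨f, φ, hf, hφ, hfp, fun x => ?_, fun x => hφ0 _ ⟨x, rfl⟩, hφ1⟩
  obtain ⟨_, ⟨y, -, rfl⟩, h1, h2⟩ := hfc _ rfl x
  exact hUδ y _ h1 _ h2

theorem SepApprox.image {X X' B : Type*} [TopologicalSpace X] [TopologicalSpace X']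
    {p : X → B} {p' : X' → B} {Z : Set X} (hZ : SepApprox p Z) (e : X ≃ₜ X')
    (he : ∀ x, p' (e x) = p x) : SepApprox p' (e '' Z) := by
  intro δ hδ h1
  obtain ⟨f, φ, hf, hφ, hfp, hfδ, hφ0, hφ1⟩ := hZ (fun q => δ (e q.1, e q.2)) (by fun_prop)
    fun x => h1 _
  refine ⟨fun x => e (f (e.symm x)), fun x => φ (e.symm x), by fun_prop, by fun_prop,
    fun x => by simp [he, hfp, ← he (e.symm x)], fun x => by simpa using hfδ (e.symm x),
    fun x => by simp [hφ0], ?_⟩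
  rintro _ ⟨z, hz, rfl⟩
  simp [hφ1 z hz]

/-- The truncation of a sequence before the `n`-th term. -/
def trunc {E : Type*} [Zero E] (n : ℕ) (v : ℕ → E) : ℕ → E := fun k => if k < n then v k else 0

theorem trunc_of_lt {E : Type*} [Zero E] {n k : ℕ} (v : ℕ → E) (h : k < n) : trunc n v k = v k :=
  if_pos h

theorem continuous_trunc {E : Type*} [Zero E] [TopologicalSpace E] (n : ℕ) :
    Continuous (trunc n : (ℕ → E) → ℕ → E) := by
  refine continuous_pi fun k => ?_
  by_cases h : k < n <;> simp only [trunc, h, if_true, if_false] <;> fun_prop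

theorem exists_eventually_of_agree {B E : Type*} [TopologicalSpace B] [TopologicalSpace E]
    (y : B × (ℕ → E)) {O : Set (B × (ℕ → E))} (hO : O ∈ 𝓝 y) :
    ∃ n, ∀ᶠ y' in 𝓝 y, ∀ w : ℕ → E, (∀ k < n, w k = y'.2 k) → (y'.1, w) ∈ O := by
  obtain ⟨P, hP, Q, hQ, hPQ⟩ := mem_nhds_prod_iff.1 hO
  obtain ⟨Q', hQ', hQo, hyQ⟩ := mem_nhds_iff.1 hQ
  obtain ⟨s, u, hu, hus⟩ := isOpen_pi_iff.1 hQo y.2 hyQ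
  obtain ⟨n, hn⟩ := s.bddAbove
  have h2 : (s : Set ℕ).pi u ∈ 𝓝 y.2 := set_pi_mem_nhds s.finite_toSet fun i hi =>
    (hu i hi).1.mem_nhds (hu i hi).2
  refine ⟨n + 1, ?_⟩
  filter_upwards [prod_mem_nhds hP h2] with y' hy' w hw
  refine hPQ ⟨hy'.1, hQ' (hus fun i hi => ?_)⟩
  have := hy'.2 i hi
  rwa [← hw i (Nat.lt_succ_of_le (hn hi))] at this

section Insertion

variable {B E : Type*} [AddCommGroup E] [Module ℝ E]

/-- The state of the rotation process: the terms produced so far and the current remainder. -/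
def rotState (c s : ℕ → B × (ℕ → E) → ℝ) (b : B) (v : ℕ → E) (r : E) : ℕ → (ℕ → E) × E
  | 0 => (0, r)
  | n + 1 =>
    let w := rotState c s b v r n
    (Function.update w.1 n (c n (b, w.1) • v n + s n (b, w.1) • w.2),
      c n (b, w.1) • w.2 - s n (b, w.1) • v n)

theorem rotState_fst_of_le (c s : ℕ → B × (ℕ → E) → ℝ) (b : B) (v : ℕ → E) (r : E) (n k : ℕ)
    (h : n ≤ k) : (rotState c s b v r n).1 k = 0 := by
  induction n with
  | zero => rfl
  | succ n ih =>
    simp only [rotState]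
    rw [Function.update_of_ne (by omega), ih (by omega)]

/-- The sequence produced by the rotation process. -/
def rotSeq (c s : ℕ → B × (ℕ → E) → ℝ) (b : B) (v : ℕ → E) (r : E) : ℕ → E :=
  fun n => (rotState c s b v r (n + 1)).1 n

theorem rotState_fst (c s : ℕ → B × (ℕ → E) → ℝ) (b : B) (v : ℕ → E) (r : E) (n : ℕ) :
    (rotState c s b v r n).1 = trunc n (rotSeq c s b v r) := by
  induction n with
  | zero => rfl
  | succ n ih =>
    funext k
    rcases lt_trichotomy k n with h | rfl | h
    · rw [trunc_of_lt _ (by omega)]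
      simp only [rotState]
      rw [Function.update_of_ne (by omega), ih, trunc_of_lt _ h]
    · rw [trunc_of_lt _ (by omega)]
      rfl
    · rw [rotState_fst_of_le _ _ _ _ _ _ _ (by omega), trunc, if_neg (by omega)]

theorem rotSeq_apply (c s : ℕ → B × (ℕ → E) → ℝ) (b : B) (v : ℕ → E) (r : E) (n : ℕ) :
    rotSeq c s b v r n = c n (b, trunc n (rotSeq c s b v r)) • v n +
      s n (b, trunc n (rotSeq c s b v r)) • (rotState c s b v r n).2 := by
  rw [← rotState_fst]
  simp [rotSeq, rotState]

theorem rotState_snd_succ (c s : ℕ → B × (ℕ → E) → ℝ) (b : B) (v : ℕ → E) (r : E) (n : ℕ) :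
    (rotState c s b v r (n + 1)).2 =
      c n (b, trunc n (rotSeq c s b v r)) • (rotState c s b v r n).2 -
      s n (b, trunc n (rotSeq c s b v r)) • v n := by
  rw [← rotState_fst]
  simp [rotState]

variable [TopologicalSpace B] [TopologicalSpace E]

theorem continuous_rotState [ContinuousAdd E] [ContinuousSub E] [ContinuousSMul ℝ E]
    {c s : ℕ → B × (ℕ → E) → ℝ} (hc : ∀ n, Continuous (c n)) (hs : ∀ n, Continuous (s n)) (n : ℕ) :
    Continuous fun x : (B × (ℕ → E)) × E => rotState c s x.1.1 x.1.2 x.2 n := by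
  induction n with
  | zero => exact continuous_const.prodMk continuous_snd
  | succ n ih =>
    simp only [rotState]
    have hb := (continuous_fst.comp continuous_fst).prodMk (continuous_fst.comp ih)
    have hv : Continuous fun x : (B × (ℕ → E)) × E => x.1.2 n := by fun_prop
    have hr := continuous_snd.comp ih
    have hcc := (hc n).comp hb
    have hss := (hs n).comp hb
    exact ((continuous_fst.comp ih).update n ((hcc.smul hv).add (hss.smul hr))).prodMk
      ((hcc.smul hr).sub (hss.smul hv))

/-- The remainder recovered from the sequence produced by the rotation process. -/
noncomputable def rotRem (c s : ℕ → B × (ℕ → E) → ℝ) (n : ℕ) (y : B × (ℕ → E)) : E :=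
  ∑' j, ((∏ i ∈ Finset.range j, c (n + i) (y.1, trunc (n + i) y.2)) *
    s (n + j) (y.1, trunc (n + j) y.2)) • y.2 (n + j)

theorem evZero_rotRem {c s : ℕ → B × (ℕ → E) → ℝ}
    (hev : EvZero fun n (y : B × (ℕ → E)) => c n (y.1, trunc n y.2)) (n : ℕ) :
    EvZero fun j (y : B × (ℕ → E)) =>
      ((∏ i ∈ Finset.range j, c (n + i) (y.1, trunc (n + i) y.2)) *
        s (n + j) (y.1, trunc (n + j) y.2)) • y.2 (n + j) := by
  intro y
  obtain ⟨N, hN⟩ := hev y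
  refine ⟨N + 1, hN.mono fun y' hy' j hj => ?_⟩
  simp only
  rw [Finset.prod_eq_zero (Finset.mem_range.2 (show N < j by omega)) (hy' _ (by omega)),
    zero_mul, zero_smul]

theorem continuous_rotRem [IsTopologicalAddGroup E] [ContinuousSMul ℝ E]
    {c s : ℕ → B × (ℕ → E) → ℝ} (hc : ∀ n, Continuous (c n)) (hs : ∀ n, Continuous (s n))
    (hev : EvZero fun n (y : B × (ℕ → E)) => c n (y.1, trunc n y.2)) (n : ℕ) :
    Continuous (rotRem c s n) := by
  have ht : ∀ m, Continuous fun y : B × (ℕ → E) => (y.1, trunc m y.2) := fun m =>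
    continuous_fst.prodMk ((continuous_trunc m).comp continuous_snd)
  exact (evZero_rotRem hev n).continuous_tsum fun j => ((continuous_finsetProd _ fun i _ =>
    (hc _).comp (ht _)).mul ((hs _).comp (ht _))).smul (by fun_prop)

theorem rotRem_eq [IsTopologicalAddGroup E] [ContinuousSMul ℝ E] [T2Space E]
    {c s : ℕ → B × (ℕ → E) → ℝ}
    (hev : EvZero fun n (y : B × (ℕ → E)) => c n (y.1, trunc n y.2)) (n : ℕ) (y : B × (ℕ → E)) :
    rotRem c s n y = s n (y.1, trunc n y.2) • y.2 n +
      c n (y.1, trunc n y.2) • rotRem c s (n + 1) y := by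
  have hsum : ∀ n, Summable fun j =>
      ((∏ i ∈ Finset.range j, c (n + i) (y.1, trunc (n + i) y.2)) *
        s (n + j) (y.1, trunc (n + j) y.2)) • y.2 (n + j) := by
    intro n
    obtain ⟨N, hN⟩ := evZero_rotRem (s := s) hev n y
    exact summable_of_ne_finset_zero (s := Finset.range N) fun i hi =>
      hN.self_of_nhds i (by simpa using hi)
  rw [rotRem, (hsum n).tsum_eq_zero_add]
  congr 1
  · simp
  · rw [rotRem, ← (hsum (n + 1)).tsum_const_smul]
    refine tsum_congr fun j => ?_
    rw [Finset.prod_range_succ', smul_smul]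
    have e : ∀ i, n + (i + 1) = n + 1 + i := fun i => by omega
    rw [Finset.prod_congr rfl fun i _ => by rw [e i], e j, add_zero]
    congr 1
    ring

theorem rotRem_rotSeq [IsTopologicalAddGroup E] [ContinuousSMul ℝ E] [T2Space E]
    {c s : ℕ → B × (ℕ → E) → ℝ} (hcs : ∀ n y, c n y ^ 2 + s n y ^ 2 = 1)
    (hev : EvZero fun n (y : B × (ℕ → E)) => c n (y.1, trunc n y.2))
    (b : B) (v : ℕ → E) (r : E) (n : ℕ) :
    rotRem c s n (b, rotSeq c s b v r) = (rotState c s b v r n).2 := by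
  obtain ⟨N, hN⟩ : ∃ N, ∀ m ≥ N, c m (b, trunc m (rotSeq c s b v r)) = 0 := by
    obtain ⟨N, hN⟩ := hev (b, rotSeq c s b v r)
    exact ⟨N, hN.self_of_nhds⟩
  have h1 : ∀ m, (rotState c s b v r m).2 =
      s m (b, trunc m (rotSeq c s b v r)) • rotSeq c s b v r m +
      c m (b, trunc m (rotSeq c s b v r)) • (rotState c s b v r (m + 1)).2 := by
    intro m
    have e := rotSeq_apply c s b v r m
    rw [rotState_snd_succ]
    generalize ht : trunc m (rotSeq c s b v r) = t at e ⊢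
    rw [e]
    rw [← ht]
    have := hcs m (b, trunc m (rotSeq c s b v r))
    generalize c m (b, trunc m (rotSeq c s b v r)) = c' at this ⊢
    generalize s m (b, trunc m (rotSeq c s b v r)) = s' at this ⊢
    generalize (rotState c s b v r m).2 = r'
    calc r' = (c' ^ 2 + s' ^ 2) • r' := by rw [this, one_smul]
      _ = _ := by module
  by_cases h : N ≤ n
  · rw [rotRem_eq hev, h1]
    simp only [hN n h, zero_smul]
  · obtain ⟨k, rfl⟩ : ∃ k, N = n + k := ⟨N - n, by omega⟩
    clear h
    induction k generalizing n with
    | zero => 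
      rw [rotRem_eq hev, h1]
      simp only [hN n le_rfl, zero_smul]
    | succ k ih => rw [rotRem_eq hev, h1, ih (n + 1) (fun m hm => hN m (by omega))]

end Insertion

/-- A factor can be absorbed by a homeomorphism that is close to the projection. -/
theorem exists_absorb_homeomorph {B E : Type*} [TopologicalSpace B]
    [TopologicalSpace E] [TopologicalSpace.MetrizableSpace (B × (ℕ → E))] [T2Space E]
    [AddCommGroup E] [Module ℝ E] [IsTopologicalAddGroup E] [ContinuousSMul ℝ E]
    (δ : (B × (ℕ → E)) × (B × (ℕ → E)) → ℝ) (hδ : Continuous δ) (h1 : ∀ y, δ (y, y) < 1) :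
    ∃ Θ : (B × (ℕ → E)) × E ≃ₜ B × (ℕ → E), (∀ x, (Θ x).1 = x.1.1) ∧
      ∀ x, δ (Θ x, x.1) < 1 := by
  let _ := TopologicalSpace.metrizableSpaceMetric (B × (ℕ → E))
  let G : ℕ → Set (B × (ℕ → E)) := fun n => {x | ∀ w w' : ℕ → E, (∀ k < n, w k = x.2 k) →
    (∀ k < n, w' k = x.2 k) → δ ((x.1, w), (x.1, w')) < 1}
  obtain ⟨η, hηc, hη01, hηO, hηev⟩ := exists_increasing_partition (fun n => interior (G n))
    (fun n => isOpen_interior)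
    (fun m n hmn => interior_mono fun x hx w w' hw hw' =>
      hx w w' (fun k hk => hw k (hk.trans_le hmn)) fun k hk => hw' k (hk.trans_le hmn))
    (by
      intro y
      have : {q | δ q < 1} ∈ 𝓝 (y, y) := (isOpen_Iio.preimage hδ).mem_nhds (h1 y)
      rw [nhds_prod_eq, Filter.mem_prod_self_iff] at this
      obtain ⟨t, ht, hts⟩ := this
      obtain ⟨n, hn⟩ := exists_eventually_of_agree y ht
      refine ⟨n, mem_interior_iff_mem_nhds.2 (hn.mono fun y' hy' w w' hw hw' => ?_)⟩
      exact hts (mk_mem_prod (hy' w hw) (hy' w' hw')))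
  let c : ℕ → B × (ℕ → E) → ℝ := fun n x => Real.cos (Real.pi / 2 * η n x)
  let s : ℕ → B × (ℕ → E) → ℝ := fun n x => Real.sin (Real.pi / 2 * η n x)
  have hc : ∀ n, Continuous (c n) := fun n => by fun_prop
  have hs : ∀ n, Continuous (s n) := fun n => by fun_prop
  have hcs : ∀ n y, c n y ^ 2 + s n y ^ 2 = 1 := fun n y => Real.cos_sq_add_sin_sq _
  have hη1 : ∀ y : B × (ℕ → E), ∃ N, ∀ᶠ y' in 𝓝 y, ∀ m ≥ N, η m (y'.1, trunc m y'.2) = 1 := by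
    intro y
    obtain ⟨n, hn⟩ := hηev y
    obtain ⟨n', hn'⟩ := exists_eventually_of_agree y hn
    refine ⟨max n n', hn'.mono fun y' hy' m hm => ?_⟩
    have := hy' (trunc m y'.2) (fun k hk => trunc_of_lt _ (by omega)) m (by omega)
    linarith
  have hev : EvZero fun n (y : B × (ℕ → E)) => c n (y.1, trunc n y.2) := by
    intro y
    obtain ⟨N, hN⟩ := hη1 y
    refine ⟨N, hN.mono fun y' hy' m hm => ?_⟩
    simp only [c, hy' m hm, mul_one, Real.cos_pi_div_two]
  have hci : ∀ n, Continuous (rotRem c s n) := continuous_rotRem hc hs hev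
  have ht : ∀ m, Continuous fun y : B × (ℕ → E) => (y.1, trunc m y.2) := fun m =>
    continuous_fst.prodMk ((continuous_trunc m).comp continuous_snd)
  let back : B × (ℕ → E) → ℕ → E := fun y n => c n (y.1, trunc n y.2) • y.2 n -
    s n (y.1, trunc n y.2) • rotRem c s (n + 1) y
  have hback : ∀ y : B × (ℕ → E), (∀ n, (rotState c s y.1 (back y) (rotRem c s 0 y) n) =
      (trunc n y.2, rotRem c s n y)) := by
    intro y n
    induction n with
    | zero => rfl
    | succ n ih =>
      have h2 := hcs n (y.1, trunc n y.2)
      have h3 := rotRem_eq (s := s) hev n y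
      rw [rotState]
      simp only [ih, back]
      rw [h3]
      generalize c n (y.1, trunc n y.2) = c' at h2 ⊢
      generalize s n (y.1, trunc n y.2) = s' at h2 ⊢
      generalize rotRem c s (n + 1) y = r'
      refine Prod.ext (funext fun k => ?_) ?_
      · simp only
        rcases lt_trichotomy k n with h | rfl | h
        · rw [Function.update_of_ne (by omega), trunc_of_lt _ h, trunc_of_lt _ (by omega)]
        · rw [Function.update_self, trunc_of_lt _ (by omega)]
          calc _ = (c' ^ 2 + s' ^ 2) • y.2 k := by module
            _ = _ := by rw [h2, one_smul]
        · rw [Function.update_of_ne (by omega), trunc, trunc, if_neg (by omega), if_neg (by omega)]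
      · calc _ = (c' ^ 2 + s' ^ 2) • r' := by module
          _ = _ := by rw [h2, one_smul]
  have hfwd : ∀ (b : B) (v : ℕ → E) (r : E), back (b, rotSeq c s b v r) = v := by
    intro b v r
    funext n
    have h2 := hcs n (b, trunc n (rotSeq c s b v r))
    have h3 := rotSeq_apply c s b v r n
    simp only [back, rotRem_rotSeq hcs hev, rotState_snd_succ]
    generalize trunc n (rotSeq c s b v r) = t at h2 h3 ⊢
    rw [h3]
    generalize c n (b, t) = c' at h2 ⊢
    generalize s n (b, t) = s' at h2 ⊢
    calc _ = (c' ^ 2 + s' ^ 2) • v n := by module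
      _ = _ := by rw [h2, one_smul]
  let Θ : (B × (ℕ → E)) × E ≃ₜ B × (ℕ → E) :=
    { toFun := fun x => (x.1.1, rotSeq c s x.1.1 x.1.2 x.2)
      invFun := fun y => ((y.1, back y), rotRem c s 0 y)
      left_inv := fun x => by
        simp only [hfwd, rotRem_rotSeq hcs hev]
        rfl
      right_inv := fun y => by
        refine Prod.ext rfl (funext fun n => ?_)
        simp only [rotSeq, hback]
        exact trunc_of_lt _ (by omega)
      continuous_toFun := (continuous_fst.comp continuous_fst).prodMk (continuous_pi fun n =>
        (continuous_apply n).comp (continuous_fst.comp (continuous_rotState hc hs (n + 1))))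
      continuous_invFun := (continuous_fst.prodMk (continuous_pi fun n =>
        ((((hc n).comp (ht n)).smul (by fun_prop)).sub (((hs n).comp (ht n)).smul
          (hci (n + 1)))))).prodMk (hci 0) }
  refine ⟨Θ, fun x => rfl, fun x => ?_⟩
  obtain ⟨⟨b, v⟩, r⟩ := x
  change δ ((b, rotSeq c s b v r), (b, v)) < 1
  have hex : ∃ n, η n (b, trunc n (rotSeq c s b v r)) ≠ 0 := by
    obtain ⟨N, hN⟩ := hη1 (b, rotSeq c s b v r)
    exact ⟨N, by rw [hN.self_of_nhds N le_rfl]; exact one_ne_zero⟩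
  classical
  have hk := Nat.find_spec hex
  have hlt : ∀ m < Nat.find hex, η m (b, trunc m (rotSeq c s b v r)) = 0 := fun m hm =>
    not_not.1 (Nat.find_min hex hm)
  generalize Nat.find hex = k at hk hlt
  refine interior_subset (hηO _ _ hk) _ _ (fun i hi => (trunc_of_lt _ hi).symm) fun i hi => ?_
  simp only
  rw [trunc_of_lt _ hi, rotSeq_apply]
  simp [c, s, hlt i hi]

theorem exists_absorb_homeomorph_seq {B : Type*} [TopologicalSpace B]
    [TopologicalSpace.MetrizableSpace B]
    (δ : (B × (ℕ → ℝ)) × (B × (ℕ → ℝ)) → ℝ) (hδ : Continuous δ) (h1 : ∀ y, δ (y, y) < 1) :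
    ∃ Θ : (B × (ℕ → ℝ)) × (ℕ → ℝ) ≃ₜ B × (ℕ → ℝ), (∀ x, (Θ x).1 = x.1.1) ∧
      ∀ x, δ (Θ x, x.1) < 1 := by
  obtain ⟨e⟩ : Nonempty (ℕ ≃ ℕ × ℕ) := inferInstance
  let c : B × (ℕ → ℝ) ≃ₜ B × (ℕ → ℕ → ℝ) :=
    (Homeomorph.refl B).prodCongr ((arrowHomeomorph e).trans Homeomorph.piCurry)
  have := c.symm.isEmbedding.metrizableSpace
  obtain ⟨Θ, hΘ1, hΘ2⟩ := exists_absorb_homeomorph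
    (fun q : (B × (ℕ → ℕ → ℝ)) × (B × (ℕ → ℕ → ℝ)) => δ (c.symm q.1, c.symm q.2))
    (by fun_prop) fun y => h1 _
  refine ⟨((c.prodCongr (Homeomorph.refl _)).trans Θ).trans c.symm, fun x => hΘ1 _, fun x => ?_⟩
  have := hΘ2 (c x.1, x.2)
  rwa [c.symm_apply_apply] at this

/-- Fixed points of a family of contractions of the line depend continuously on the parameter. -/
theorem exists_continuous_fixedPoint {P : Type*} [TopologicalSpace P] (F : P × ℝ → ℝ)
    (hF : Continuous F) (hl : ∀ p s t, |F (p, s) - F (p, t)| ≤ 1 / 2 * |s - t|) :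
    ∃ σ : P → ℝ, Continuous σ ∧ (∀ p, F (p, σ p) = σ p) ∧ ∀ p s, F (p, s) = s → s = σ p := by
  have hcon : ∀ p, ContractingWith (1 / 2) fun s => F (p, s) := fun p => by
    refine ⟨?_, LipschitzWith.of_dist_le_mul fun s t => ?_⟩
    · rw [← NNReal.coe_lt_coe]
      norm_num
    · simpa [Real.dist_eq] using hl p s t
  let σ : P → ℝ := fun p => (hcon p).fixedPoint _
  have hσ : ∀ p, F (p, σ p) = σ p := fun p => (hcon p).fixedPoint_isFixedPt
  refine ⟨σ, ?_, hσ, fun p s hs => (hcon p).fixedPoint_unique hs⟩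
  rw [continuous_iff_continuousAt]
  intro p
  rw [ContinuousAt, tendsto_iff_dist_tendsto_zero]
  have h0 : Filter.Tendsto (fun p' => 2 * |F (p', σ p) - σ p|) (𝓝 p) (𝓝 0) := by
    have hc : Continuous fun p' => 2 * |F (p', σ p) - σ p| := by fun_prop
    have := hc.tendsto p
    simpa [hσ p] using this
  refine squeeze_zero (fun _ => dist_nonneg) (fun p' => ?_) h0
  rw [Real.dist_eq]
  have h1 := hl p' (σ p') (σ p)
  have h2 := abs_sub_le (F (p', σ p')) (F (p', σ p)) (σ p)
  rw [hσ p'] at h1 h2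
  linarith

/-- Moving along a direction field by a contracting amount is a homeomorphism. -/
theorem exists_move_homeomorph {Q : Type*} [TopologicalSpace Q] (w : Q → ℕ → ℝ)
    (hw : Continuous w) (l : Q × (ℕ → ℝ) → ℝ) (hl : Continuous l)
    (hlip : ∀ q y s t, |l (q, y + s • w q) - l (q, y + t • w q)| ≤ 1 / 2 * |s - t|) :
    ∃ H : Q × (ℕ → ℝ) ≃ₜ Q × (ℕ → ℝ), ∀ x, H x = (x.1, x.2 + l x • w x.1) := by
  obtain ⟨σ, hσc, hσ, hσu⟩ := exists_continuous_fixedPoint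
    (fun p : (Q × (ℕ → ℝ)) × ℝ => l (p.1.1, p.1.2 + (-p.2) • w p.1.1)) (by fun_prop)
    (fun p s t => (hlip p.1 p.2 (-s) (-t)).trans_eq (by
      rw [← abs_neg (s - t)]
      ring_nf))
  refine ⟨{ toFun := fun x => (x.1, x.2 + l x • w x.1)
            invFun := fun x => (x.1, x.2 + (-σ x) • w x.1)
            left_inv := fun x => ?_
            right_inv := fun x => ?_
            continuous_toFun := by fun_prop
            continuous_invFun := by fun_prop }, fun x => rfl⟩
  · have : l x = σ (x.1, x.2 + l x • w x.1) := hσu _ _ (by simp [add_assoc])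
    refine Prod.ext rfl ?_
    simp only [← this]
    module
  · refine Prod.ext rfl ?_
    have := hσ x
    simp only at this ⊢
    rw [this]
    module

theorem exists_avoiding_absorb_homeomorph {B : Type*} [TopologicalSpace B]
    [TopologicalSpace.MetrizableSpace B] {Z : Set (B × (ℕ → ℝ))} (hZ : SepApprox Prod.fst Z)
    (d : (B × (ℕ → ℝ)) × (B × (ℕ → ℝ)) → ℝ) (hd : Continuous d) (hd0 : ∀ x, d (x, x) = 0)
    (hsymm : ∀ x y, d (x, y) = d (y, x)) (htri : ∀ x y z, d (x, z) ≤ d (x, y) + d (y, z)) :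
    ∃ (G : (B × (ℕ → ℝ)) × (ℕ → ℝ) ≃ₜ B × (ℕ → ℝ)) (φ : B × (ℕ → ℝ) → ℝ),
      (∀ x, (G x).1 = x.1.1) ∧ (∀ x, d (G x, x.1) < 1) ∧ Continuous φ ∧
      (∀ x, φ (G (x, 0)) = 0) ∧ ∀ z ∈ Z, φ z = 1 := by
  obtain ⟨μ, hμc, hμ0, hμev, hμ⟩ := exists_gauge_of_metrizable
    (fun p : (B × (ℕ → ℝ)) × (ℕ → ℝ) => 4 * d ((p.1.1, p.1.2 + p.2), p.1)) (by fun_prop)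
    (fun y => by simp [hd0])
  have hev : ∀ {Y : Type _} [TopologicalSpace Y] (a : ℕ → Y → ℝ) (g : Y → B × (ℕ → ℝ)),
      Continuous g → EvZero fun i y => μ i (g y) * |a i y| := fun a g hg =>
    (hμev.comp hg).of_imp fun i y h => by rw [h, zero_mul]
  have hnn : ∀ i y (t : ℝ), 0 ≤ μ i y * |t| := fun i y t => mul_nonneg (hμ0 i y) (abs_nonneg t)
  have hsum : ∀ (y : B × (ℕ → ℝ)) (t : ℕ → ℝ), Summable fun i => μ i y * |t i| := fun y t =>
    (hev (fun i _ => t i) id continuous_id).summable y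
  have hle : ∀ (y : B × (ℕ → ℝ)) (t : ℕ → ℝ) i, μ i y * |t i| ≤ ∑' j, μ j y * |t j| :=
    fun y t i => (hsum y t).le_tsum i fun j _ => hnn j y _
  obtain ⟨f, φ, hf, hφ, hfp, hfδ, hφ0, hφ1⟩ := hZ
    (fun q => 4 * ∑' i, μ i q.2 * |q.1.2 i - q.2.2 i|)
    (continuous_const.mul ((hev (fun i (q : (B × (ℕ → ℝ)) × (B × (ℕ → ℝ))) => q.1.2 i - q.2.2 i)
      Prod.snd continuous_snd).continuous_tsum fun i =>
        ((hμc i).comp continuous_snd).mul (by fun_prop)))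
    (fun x => by simp)
  obtain ⟨Θ, hΘ1, hΘ2⟩ := exists_absorb_homeomorph_seq
    (fun q => max (2 * d q) (2 * |φ q.1 - φ q.2|)) (by fun_prop) (fun y => by simp [hd0])
  let w : B × (ℕ → ℝ) → ℕ → ℝ := fun q => (f q).2 - q.2
  have hw : Continuous w := by fun_prop
  have hws : ∀ q, ∑' i, μ i q * |w q i| < 1 / 4 := fun q => by
    have := hfδ q
    simp only [w, Pi.sub_apply] at this ⊢
    linarith
  let l : (B × (ℕ → ℝ)) × (ℕ → ℝ) → ℝ := fun p =>
    max 0 (1 - 2 * ∑' i, μ i p.1 * |p.2 i - p.1.2 i|)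
  have hl : Continuous l := continuous_const.max (continuous_const.sub (continuous_const.mul
    ((hev (fun i (p : (B × (ℕ → ℝ)) × (ℕ → ℝ)) => p.2 i - p.1.2 i)
      Prod.fst continuous_fst).continuous_tsum fun i =>
        ((hμc i).comp continuous_fst).mul (by fun_prop))))
  have hone : ∀ (q : B × (ℕ → ℝ)) (a b : ℕ → ℝ), ∑' i, μ i q * |a i| ≤
      ∑' i, μ i q * |b i| + ∑' i, μ i q * |a i - b i| := by
    intro q a b
    rw [← (hsum q b).tsum_add (hsum q fun i => a i - b i)]
    refine (hsum q a).tsum_le_tsum (fun i => ?_) ((hsum q b).add (hsum q fun i => a i - b i))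
    rw [← mul_add]
    refine mul_le_mul_of_nonneg_left ?_ (hμ0 i q)
    have := abs_add_le (b i) (a i - b i)
    rwa [add_sub_cancel] at this
  have hscale : ∀ (q : B × (ℕ → ℝ)) (s : ℝ), ∑' i, μ i q * |s * w q i| ≤ |s| * (1 / 4) := by
    intro q s
    have : ∀ i, μ i q * |s * w q i| = |s| * (μ i q * |w q i|) := fun i => by
      rw [abs_mul]
      ring
    simp only [this]
    rw [(hsum q (w q)).tsum_mul_left]
    exact mul_le_mul_of_nonneg_left (hws q).le (abs_nonneg s)
  have hlip1 : ∀ q y s t, l (q, y + s • w q) - l (q, y + t • w q) ≤ 1 / 2 * |s - t| := by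
    intro q y s t
    have h1 := hone q (fun i => (y + t • w q) i - q.2 i) (fun i => (y + s • w q) i - q.2 i)
    have h2 := hscale q (t - s)
    have h3 : ∀ i, (y + t • w q) i - q.2 i - ((y + s • w q) i - q.2 i) = (t - s) * w q i :=
      fun i => by
        simp only [Pi.add_apply, Pi.smul_apply, smul_eq_mul]
        ring
    simp only [h3] at h1
    rw [abs_sub_comm] at h2
    have h4 : 0 ≤ 1 / 2 * |s - t| := by positivity
    simp only [l]
    rw [sub_le_iff_le_add]
    refine max_le (add_nonneg h4 (le_max_left _ _)) ?_
    have h5 := le_max_right 0 (1 - 2 * ∑' i, μ i q * |(y + t • w q) i - q.2 i|)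
    linarith
  obtain ⟨H, hH⟩ := exists_move_homeomorph w hw l hl fun q y s t =>
    abs_le.2 ⟨by linarith [hlip1 q y t s, abs_sub_comm s t], hlip1 q y s t⟩
  let A : (B × (ℕ → ℝ)) × (ℕ → ℝ) ≃ₜ (B × (ℕ → ℝ)) × (ℕ → ℝ) :=
    { toFun := fun x => ((x.1.1, x.2 + x.1.2), x.1.2)
      invFun := fun x => ((x.1.1, x.2), x.1.2 - x.2)
      left_inv := fun x => by simp
      right_inv := fun x => by simp
      continuous_toFun := by fun_prop
      continuous_invFun := by fun_prop }
  let C : (B × (ℕ → ℝ)) × (ℕ → ℝ) ≃ₜ (B × (ℕ → ℝ)) × (ℕ → ℝ) :=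
    { toFun := fun x => ((x.1.1, x.2), x.1.2)
      invFun := fun x => ((x.1.1, x.2), x.1.2)
      left_inv := fun x => rfl
      right_inv := fun x => rfl
      continuous_toFun := by fun_prop
      continuous_invFun := by fun_prop }
  have hG : ∀ (b : B) (y r : ℕ → ℝ), (((A.trans H).trans C).trans Θ) ((b, y), r) =
      Θ ((b, y + l ((b, r + y), y) • w (b, r + y)), r + y) := fun b y r =>
    congrArg (fun x => Θ (C x)) (hH _)
  refine ⟨((A.trans H).trans C).trans Θ, fun x => max 0 (2 * φ x - 1), ?_, ?_, by fun_prop, ?_, ?_⟩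
  · rintro ⟨⟨b, y⟩, r⟩
    rw [hG, hΘ1]
  · rintro ⟨⟨b, y⟩, r⟩
    rw [hG]
    simp only
    set ρ := r + y
    have hmax := (le_max_left _ _).trans_lt (hΘ2 ((b, y + l ((b, ρ), y) • w (b, ρ)), ρ))
    have ht := htri (Θ ((b, y + l ((b, ρ), y) • w (b, ρ)), ρ)) (b, y + l ((b, ρ), y) • w (b, ρ))
      (b, y)
    rcases le_or_gt (1 - 2 * ∑' i, μ i (b, ρ) * |y i - ρ i|) 0 with h | h
    · have h0 : l ((b, ρ), y) = 0 := max_eq_left h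
      rw [h0, zero_smul, add_zero] at hmax ht ⊢
      rw [hd0] at ht
      linarith
    · have hl1 : l ((b, ρ), y) = 1 - 2 * ∑' i, μ i (b, ρ) * |y i - ρ i| := max_eq_right h.le
      have hl0 : |l ((b, ρ), y)| ≤ 1 := by
        rw [hl1, abs_of_pos h]
        have : 0 ≤ ∑' i, μ i (b, ρ) * |y i - ρ i| := tsum_nonneg fun i => hnn _ _ _
        linarith
      have e1 := hμ (b, ρ) (y - ρ) fun i => by
        have := hle (b, ρ) (fun i => y i - ρ i) i
        simp only [Pi.sub_apply]
        linarith
      have e2 := hμ (b, ρ) (y + l ((b, ρ), y) • w (b, ρ) - ρ) fun i => by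
        have h1 := hle (b, ρ) (fun i => y i + l ((b, ρ), y) * w (b, ρ) i - ρ i) i
        have h2 := hone (b, ρ) (fun i => y i + l ((b, ρ), y) * w (b, ρ) i - ρ i)
          (fun i => y i - ρ i)
        have h3 : ∀ i, y i + l ((b, ρ), y) * w (b, ρ) i - ρ i - (y i - ρ i) =
          l ((b, ρ), y) * w (b, ρ) i := fun i => by ring
        simp only [h3] at h2
        have h4 := hscale (b, ρ) (l ((b, ρ), y))
        simp only [Pi.sub_apply, Pi.add_apply, Pi.smul_apply, smul_eq_mul]
        linarith
      simp only [add_sub_cancel] at e1 e2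
      have ht2 := htri (b, y + l ((b, ρ), y) • w (b, ρ)) (b, ρ) (b, y)
      rw [hsymm (b, ρ) (b, y)] at ht2
      linarith
  · rintro ⟨b, y⟩
    rw [hG]
    have h0 : l ((b, 0 + y), y) = 1 := by simp [l]
    have h1 : y + w (b, y) = (f (b, y)).2 := by simp [w]
    have h2 : (b, (f (b, y)).2) = f (b, y) := Prod.ext (hfp (b, y)).symm rfl
    rw [h0, one_smul, zero_add, h1, h2]
    have := (le_max_right _ _).trans_lt (hΘ2 (f (b, y), y))
    simp only [hφ0, sub_zero] at this
    refine max_eq_left ?_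
    linarith [le_abs_self (φ (Θ (f (b, y), y)))]
  · intro z hz
    simp only [hφ1 z hz]
    norm_num

theorem le_of_tendsto_of_geometric {X : Type*} [TopologicalSpace X] (δ : X → X → ℝ)
    (hδ : Continuous fun p : X × X => δ p.1 p.2) (h0 : ∀ x, δ x x = 0)
    (htri : ∀ x y z, δ x z ≤ δ x y + δ y z) {z : ℕ → X} {a : X}
    (hz : Filter.Tendsto z Filter.atTop (𝓝 a)) {C : ℝ} (hC : 0 ≤ C)
    (h : ∀ i, δ (z i) (z (i + 1)) ≤ C * (1 / 2) ^ i) : δ (z 0) a ≤ 2 * C := by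
  have key : ∀ i, δ (z 0) (z i) ≤ 2 * C * (1 - (1 / 2) ^ i) := by
    intro i
    induction i with
    | zero => simp [h0]
    | succ i ih =>
      have := htri (z 0) (z i) (z (i + 1))
      have := h i
      rw [pow_succ]
      linarith
  have hlim : Filter.Tendsto (fun i => δ (z 0) (z i)) Filter.atTop (𝓝 (δ (z 0) a)) :=
    (hδ.tendsto (z 0, a)).comp (tendsto_const_nhds.prodMk_nhds hz)
  refine le_of_tendsto' hlim fun i => (key i).trans ?_
  have : (0 : ℝ) ≤ (1 / 2) ^ i := by positivity
  nlinarith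

/-- The composition `g m ∘ g (m + 1) ∘ ⋯ ∘ g (m + j - 1)`. -/
def tailComp {X : Type*} (g : ℕ → X → X) : ℕ → ℕ → X → X
  | 0, _ => id
  | j + 1, m => g m ∘ tailComp g j (m + 1)

theorem tailComp_succ' {X : Type*} (g : ℕ → X → X) (j m : ℕ) (x : X) :
    tailComp g (j + 1) m x = tailComp g j m (g (m + j) x) := by
  induction j generalizing m with
  | zero => rfl
  | succ j ih =>
    change g m (tailComp g (j + 1) (m + 1) x) = g m (tailComp g j (m + 1) _)
    rw [ih, show m + 1 + j = m + (j + 1) by ring]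

theorem continuous_tailComp {X : Type*} [TopologicalSpace X] {g : ℕ → X → X}
    (hg : ∀ k, Continuous (g k)) (j m : ℕ) : Continuous (tailComp g j m) := by
  induction j generalizing m with
  | zero => exact continuous_id
  | succ j ih => exact (hg m).comp (ih _)

/-- The orbit `y₀ = x`, `y_{k+1} = G k (y_k, v k)`. -/
def orbit {X V : Type*} (G : ℕ → X × V → X) (x : X) (v : ℕ → V) : ℕ → X
  | 0 => x
  | k + 1 => G k (orbit G x v k, v k)

theorem continuous_orbit {X V : Type*} [TopologicalSpace X] [TopologicalSpace V]
    {G : ℕ → X × V → X} (hG : ∀ k, Continuous (G k)) (k : ℕ) :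
    Continuous fun q : X × (ℕ → V) => orbit G q.1 q.2 k := by
  induction k with
  | zero => exact continuous_fst
  | succ k ih =>
    exact (hG k).comp (ih.prodMk ((continuous_apply k).comp continuous_snd))

theorem orbit_congr {X V : Type*} (G : ℕ → X × V → X) (x : X) {v w : ℕ → V} {k : ℕ}
    (h : ∀ i < k, v i = w i) : orbit G x v k = orbit G x w k := by
  induction k with
  | zero => rfl
  | succ k ih =>
    change G k _ = G k _
    rw [ih fun i hi => h i (by omega), h k (by omega)]

theorem exists_infinite_absorb_homeomorph {X V : Type*} [MetricSpace X] [CompleteSpace X]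
    [TopologicalSpace V] (G : ℕ → X × V ≃ₜ X) (Δ : ℕ → X → X → ℝ)
    (hΔ : ∀ k, Continuous fun p : X × X => Δ k p.1 p.2) (h0 : ∀ k x, Δ k x x = 0)
    (hsymm : ∀ k x y, Δ k x y = Δ k y x)
    (htri : ∀ k x y z, Δ k x z ≤ Δ k x y + Δ k y z) (hdist : ∀ x y, dist x y ≤ Δ 0 x y)
    (hmono : ∀ k x y, Δ k x y ≤ Δ (k + 1) x y)
    (hstep : ∀ k x y, Δ k ((G k).symm x).1 ((G k).symm y).1 ≤ Δ (k + 1) x y)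
    (hG : ∀ k q, Δ k (G k q) q.1 ≤ 1 / 4 * (1 / 2) ^ k) :
    ∃ Γ : X × (ℕ → V) ≃ₜ X,
      (∀ x v, Filter.Tendsto (orbit (fun k => G k) x v) Filter.atTop (𝓝 (Γ (x, v)))) ∧
      ∀ x v k, Δ k (orbit (fun k => G k) x v k) (Γ (x, v)) ≤ 1 / 2 := by
  have hmono' : ∀ k j x y, Δ k x y ≤ Δ (k + j) x y := by
    intro k j x y
    induction j with
    | zero => exact le_rfl
    | succ j ih => exact ih.trans (hmono _ _ _)
  have hdist' : ∀ k x y, dist x y ≤ Δ k x y := fun k x y =>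
    (hdist x y).trans (by simpa using hmono' 0 k x y)
  set y := orbit (fun k => (G k : X × V → X)) with hy
  have hyd : ∀ x v k j, Δ k (y x v (k + j)) (y x v (k + j + 1))
      ≤ 1 / 4 * (1 / 2) ^ k * (1 / 2) ^ j := by
    intro x v k j
    refine (hmono' k j _ _).trans ?_
    rw [hsymm, mul_assoc, ← pow_add]
    exact hG (k + j) (_, v (k + j))
  obtain ⟨γ, hγ, hγlim, -⟩ := exists_continuous_limit
    (fun k (q : X × (ℕ → V)) => y q.1 q.2 k)
    (continuous_orbit fun k => (G k).continuous) (1 / 4)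
    (fun k q => (hdist _ _).trans (by simpa using (hyd q.1 q.2 0 k)))
  have hyγ : ∀ x v k, Δ k (y x v k) (γ (x, v)) ≤ 2 * (1 / 4 * (1 / 2) ^ k) := by
    intro x v k
    refine le_of_tendsto_of_geometric (Δ k) (hΔ k) (h0 k) (htri k) (z := fun j => y x v (k + j))
      ?_ (by positivity) (hyd x v k)
    exact ((Filter.tendsto_add_atTop_iff_nat k).2 (hγlim (x, v))).congr fun j => by
      rw [add_comm]
  set g : ℕ → X → X := fun k x => ((G k).symm x).1 with hg
  have hgc : ∀ k, Continuous (g k) := fun k => continuous_fst.comp (G k).symm.continuous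
  have hP : ∀ j m a b, Δ m (tailComp g j m a) (tailComp g j m b) ≤ Δ (m + j) a b := by
    intro j
    induction j with
    | zero => intro m a b; exact le_rfl
    | succ j ih =>
      intro m a b
      refine (hstep m _ _).trans ((ih (m + 1) a b).trans ?_)
      rw [show m + 1 + j = m + (j + 1) by ring]
  have hgd : ∀ k x, Δ k x (g k x) ≤ 1 / 4 * (1 / 2) ^ k := fun k x => by
    simpa using hG k ((G k).symm x)
  have hPd : ∀ m j x, Δ m (tailComp g j m x) (tailComp g (j + 1) m x)
      ≤ 1 / 4 * (1 / 2) ^ m * (1 / 2) ^ j := by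
    intro m j x
    rw [tailComp_succ', mul_assoc, ← pow_add]
    exact (hP _ _ _ _).trans (hgd _ _)
  have hlim : ∀ m, ∃ P : X → X, Continuous P ∧
      ∀ x, Filter.Tendsto (fun j => tailComp g j m x) Filter.atTop (𝓝 (P x)) := by
    intro m
    obtain ⟨P, h₁, h₂, -⟩ := exists_continuous_limit (fun j => tailComp g j m)
      (fun j => continuous_tailComp hgc j m) (1 / 4 * (1 / 2) ^ m)
      (fun j x => (hdist' m _ _).trans (hPd m j x))
    exact ⟨P, h₁, h₂⟩
  choose P hPc hPlim using hlim
  have hPx : ∀ m x, Δ m x (P m x) ≤ 2 * (1 / 4 * (1 / 2) ^ m) := fun m x =>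
    le_of_tendsto_of_geometric (Δ m) (hΔ m) (h0 m) (htri m) (hPlim m x) (by positivity)
      fun j => hPd m j x
  have hPg : ∀ m x, P m x = g m (P (m + 1) x) := by
    intro m x
    refine tendsto_nhds_unique ((Filter.tendsto_add_atTop_iff_nat 1).2 (hPlim m x)) ?_
    exact ((hgc m).tendsto _).comp (hPlim (m + 1) x)
  have hGP : ∀ m x, G m (P m x, ((G m).symm (P (m + 1) x)).2) = P (m + 1) x := by
    intro m x
    rw [hPg]
    exact (G m).apply_symm_apply _
  have hpow : Filter.Tendsto (fun k : ℕ => 2 * (1 / 4 * (1 / 2 : ℝ) ^ k)) Filter.atTop (𝓝 0) := by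
    have := tendsto_pow_atTop_nhds_zero_of_lt_one (r := (1 / 2 : ℝ)) (by norm_num) (by norm_num)
    simpa only [mul_zero] using (this.const_mul (1 / 4)).const_mul 2
  have hPy : ∀ x v m, P m (γ (x, v)) = y x v m := by
    intro x v m
    have hy' : ∀ j, tailComp g j m (y x v (m + j)) = y x v m := by
      intro j
      induction j with
      | zero => rfl
      | succ j ih =>
        rw [tailComp_succ', ← ih]
        congr 1
        change ((G (m + j)).symm (G (m + j) _)).1 = _
        rw [(G (m + j)).symm_apply_apply]
        rfl
    refine tendsto_nhds_unique (hPlim m _) (tendsto_iff_dist_tendsto_zero.2 ?_)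
    refine squeeze_zero (fun _ => dist_nonneg) (fun j => ?_)
      (hpow.comp (Filter.tendsto_add_atTop_nat m))
    rw [dist_comm, ← hy' j]
    refine (hdist' m _ _).trans ((hP _ _ _ _).trans ?_)
    rw [Function.comp_apply, add_comm j m]
    exact hyγ _ _ _
  refine ⟨{ toFun := γ
            invFun := fun x => (P 0 x, fun m => ((G m).symm (P (m + 1) x)).2)
            left_inv := ?_
            right_inv := ?_
            continuous_toFun := hγ
            continuous_invFun := ?_ }, fun x v => hγlim (x, v), fun x v k => ?_⟩
  · rintro ⟨x, v⟩
    refine Prod.ext (hPy x v 0) (funext fun m => ?_)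
    change ((G m).symm (P (m + 1) (γ (x, v)))).2 = v m
    rw [hPy]
    change ((G m).symm (G m (_, v m))).2 = v m
    rw [(G m).symm_apply_apply]
  · intro x
    have hyP : ∀ k, y (P 0 x) (fun m => ((G m).symm (P (m + 1) x)).2) k = P k x := by
      intro k
      induction k with
      | zero => rfl
      | succ k ih =>
        change G k (y _ _ k, _) = _
        rw [ih, hGP]
    refine tendsto_nhds_unique (hγlim _) (tendsto_iff_dist_tendsto_zero.2 ?_)
    refine squeeze_zero (fun _ => dist_nonneg) (fun k => ?_) hpow
    rw [hyP, dist_comm]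
    exact (hdist' k _ _).trans (hPx k x)
  · exact (hPc 0).prodMk (continuous_pi fun m =>
      continuous_snd.comp ((G m).symm.continuous.comp (hPc (m + 1))))
  · refine (hyγ x v k).trans ?_
    have : (1 / 2 : ℝ) ^ k ≤ 1 := pow_le_one₀ (by norm_num) (by norm_num)
    linarith

/-- A continuous pseudometric, as a plain function. -/
structure IsContPseudoDist {X : Type*} [TopologicalSpace X] (d : X → X → ℝ) : Prop where
  continuous : Continuous fun p : X × X => d p.1 p.2
  self : ∀ x, d x x = 0
  symm : ∀ x y, d x y = d y x
  triangle : ∀ x y z, d x z ≤ d x y + d y z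

theorem IsContPseudoDist.nonneg {X : Type*} [TopologicalSpace X] {d : X → X → ℝ}
    (h : IsContPseudoDist d) (x y : X) : 0 ≤ d x y := by
  have := h.triangle x y x
  rw [h.self, h.symm y x] at this
  linarith

theorem IsContPseudoDist.refined {X : Type*} [TopologicalSpace X] {d : X → X → ℝ}
    (h : IsContPseudoDist d) {g : X → X} (hg : Continuous g) {φ : X → ℝ} (hφ : Continuous φ) :
    IsContPseudoDist fun x y => d x y + d (g x) (g y) + |φ x - φ y| where
  continuous := (h.continuous.add (h.continuous.comp ((hg.comp continuous_fst).prodMk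
    (hg.comp continuous_snd)))).add
      (((hφ.comp continuous_fst).sub (hφ.comp continuous_snd)).abs)
  self x := by simp [h.self]
  symm x y := by rw [h.symm x y, h.symm (g x), abs_sub_comm]
  triangle x y z := by
    have := h.triangle x y z
    have := h.triangle (g x) (g y) (g z)
    have := abs_sub_le (φ x) (φ y) (φ z)
    linarith

theorem SepApprox.exists_stacked_homeomorph {B : Type*} [TopologicalSpace B]
    [TopologicalSpace.IsCompletelyMetrizableSpace B] {Z : Set (B × (ℕ → ℝ))}
    (hZ : SepApprox Prod.fst Z) :
    ∃ (Γ : (B × (ℕ → ℝ)) × (ℕ → ℕ → ℝ) ≃ₜ B × (ℕ → ℝ))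
      (ψ : ℕ → (B × (ℕ → ℝ)) × (ℕ → ℕ → ℝ) → ℝ),
      (∀ q, (Γ q).1 = q.1.1) ∧ (∀ k, Continuous (ψ k)) ∧
      (∀ k x v w, (∀ i ≤ k, v i = w i) → ψ k (x, v) = ψ k (x, w)) ∧
      (∀ k q, q.2 k = 0 → ψ k q = 0) ∧ ∀ k q, Γ q ∈ Z → 1 / 2 ≤ ψ k q := by
  let _ := TopologicalSpace.upgradeIsCompletelyMetrizable (B × (ℕ → ℝ))
  have hstep : ∀ (k : ℕ) (d : {d : B × (ℕ → ℝ) → B × (ℕ → ℝ) → ℝ // IsContPseudoDist d}),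
      ∃ (G : (B × (ℕ → ℝ)) × (ℕ → ℝ) ≃ₜ B × (ℕ → ℝ)) (φ : B × (ℕ → ℝ) → ℝ),
        (∀ x, (G x).1 = x.1.1) ∧ (∀ x, d.1 (G x) x.1 ≤ 1 / 4 * (1 / 2) ^ k) ∧
        Continuous φ ∧ (∀ x, φ (G (x, 0)) = 0) ∧ ∀ z ∈ Z, φ z = 1 := by
    intro k d
    obtain ⟨G, φ, h₁, h₂, h₃⟩ := exists_avoiding_absorb_homeomorph hZ
      (fun p => 4 * 2 ^ k * d.1 p.1 p.2) (continuous_const.mul d.2.continuous)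
      (fun x => by simp [d.2.self]) (fun x y => by rw [d.2.symm])
      (fun x y z => by
        rw [← mul_add]
        exact mul_le_mul_of_nonneg_left (d.2.triangle x y z) (by positivity))
    refine ⟨G, φ, h₁, fun x => ?_, h₃⟩
    have h : 4 * 2 ^ k * d.1 (G x) x.1 < 1 := h₂ x
    have h2 : (0 : ℝ) < 2 ^ k := by positivity
    rw [one_div_pow, div_mul_div_comm, one_mul, le_div_iff₀ (by positivity), mul_comm]
    exact h.le
  choose G φ hG₁ hG₂ hφ hφ0 hφZ using hstep
  have hd0 : IsContPseudoDist fun x y : B × (ℕ → ℝ) => dist x y :=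
    ⟨continuous_dist, dist_self, dist_comm, dist_triangle⟩
  let D : ℕ → {d : B × (ℕ → ℝ) → B × (ℕ → ℝ) → ℝ // IsContPseudoDist d} := fun k =>
    Nat.rec ⟨_, hd0⟩ (fun k d => ⟨_, d.2.refined
      (continuous_fst.comp (G k d).symm.continuous) (hφ k d)⟩) k
  have hD : ∀ k x y, (D (k + 1)).1 x y = (D k).1 x y +
      (D k).1 ((G k (D k)).symm x).1 ((G k (D k)).symm y).1 +
      |φ k (D k) x - φ k (D k) y| := fun k x y => rfl
  have hn : ∀ k x y, 0 ≤ (D k).1 x y := fun k => (D k).2.nonneg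
  obtain ⟨Γ, hΓ, hΓd⟩ := exists_infinite_absorb_homeomorph (fun k => G k (D k)) (fun k => (D k).1)
    (fun k => (D k).2.continuous) (fun k => (D k).2.self) (fun k => (D k).2.symm)
    (fun k => (D k).2.triangle) (fun x y => le_rfl)
    (fun k x y => by
      rw [hD]
      have := hn k ((G k (D k)).symm x).1 ((G k (D k)).symm y).1
      have := abs_nonneg (φ k (D k) x - φ k (D k) y)
      linarith)
    (fun k x y => by
      rw [hD]
      have := hn k x y
      have := abs_nonneg (φ k (D k) x - φ k (D k) y)
      linarith)
    (fun k q => hG₂ k (D k) q)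
  have hfst : ∀ k x v, (orbit (fun k => (G k (D k) : _ → B × (ℕ → ℝ))) x v k).1 = x.1 := by
    intro k x v
    induction k with
    | zero => rfl
    | succ k ih => exact (hG₁ k (D k) _).trans ih
  refine ⟨Γ, fun k q => φ k (D k) (orbit (fun k => G k (D k)) q.1 q.2 (k + 1)), ?_, ?_, ?_, ?_, ?_⟩
  · rintro ⟨x, v⟩
    have h := (continuous_fst.tendsto _).comp (hΓ x v)
    refine tendsto_nhds_unique h (tendsto_const_nhds.congr fun k => (hfst k x v).symm)
  · exact fun k => (hφ k (D k)).comp (continuous_orbit (fun k => (G k (D k)).continuous) (k + 1))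
  · intro k x v w h
    simp only
    rw [orbit_congr _ x fun i hi => h i (by omega)]
  · rintro k ⟨x, v⟩ h
    change φ k (D k) (G k (D k) (orbit _ x v k, v k)) = 0
    have h : v k = 0 := h
    rw [h]
    exact hφ0 k (D k) _
  · rintro k ⟨x, v⟩ h
    have h1 := hφZ k (D k) _ h
    have h2 := hΓd x v (k + 1)
    rw [hD, h1] at h2
    have := hn k (orbit (fun k => G k (D k)) x v (k + 1)) (Γ (x, v))
    have := hn k ((G k (D k)).symm (orbit (fun k => G k (D k)) x v (k + 1))).1
      ((G k (D k)).symm (Γ (x, v))).1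
    have := neg_abs_le (φ k (D k) (orbit (fun k => G k (D k)) x v (k + 1)) - 1)
    simp only
    linarith

/-- Splitting a sequence into its even and odd terms. -/
def evenOddHomeomorph (V : Type*) [TopologicalSpace V] : (ℕ → V) ≃ₜ (ℕ → V × V) where
  toFun v i := (v (2 * i), v (2 * i + 1))
  invFun e k := if k % 2 = 0 then (e (k / 2)).1 else (e (k / 2)).2
  left_inv v := by
    funext k
    by_cases h : k % 2 = 0
    · simp only [h, if_true]
      congr 1
      omega
    · simp only [h, if_false]
      congr 1
      omega
  right_inv e := by
    funext i
    have h1 : (2 * i + 1) / 2 = i := by omega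
    have h2 : (2 * i + 1) % 2 ≠ 0 := by omega
    simp [h1]
  continuous_toFun := by fun_prop
  continuous_invFun := continuous_pi fun k => by
    by_cases h : k % 2 = 0
    · simp only [h, if_true]
      fun_prop
    · simp only [h, if_false]
      fun_prop

theorem SepApprox.exists_zero_coords {B : Type*} [TopologicalSpace B]
    [TopologicalSpace.IsCompletelyMetrizableSpace B] {Z : Set (B × (ℕ → ℝ))}
    (hZ : SepApprox Prod.fst Z) :
    ∃ K : B × (ℕ → ℝ) ≃ₜ (B × (ℕ → ℝ)) × (ℕ → ℝ),
      (∀ x, (K x).1.1 = x.1) ∧ ∀ z ∈ Z, (K z).2 = 0 := by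
  obtain ⟨Γ, ψ, hΓ, hψ, hψd, hψ0, hψZ⟩ := hZ.exists_stacked_homeomorph
  let ε := evenOddHomeomorph (ℕ → ℝ)
  let Γ' : (B × (ℕ → ℝ)) × (ℕ → (ℕ → ℝ) × (ℕ → ℝ)) ≃ₜ B × (ℕ → ℝ) :=
    ((Homeomorph.refl _).prodCongr ε.symm).trans Γ
  have hmod : ∀ i : ℕ, Continuous fun q : (ℕ → (ℕ → ℝ) × (ℕ → ℝ)) × (ℕ → ℝ) =>
      Function.update (trunc i q.1) i (q.2, 0) := fun i =>
    ((continuous_trunc i).comp continuous_fst).update i (continuous_snd.prodMk continuous_const)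
  have hgauge : ∀ i : ℕ, ∃ μ : ℕ → (B × (ℕ → ℝ)) × (ℕ → (ℕ → ℝ) × (ℕ → ℝ)) → ℝ,
      (∀ n, Continuous (μ n)) ∧ (∀ n y, 0 ≤ μ n y) ∧ EvZero μ ∧
      ∀ y t, (∀ n, μ n y * |t n| < 1) →
        2 * ψ (2 * i) (y.1, ε.symm (Function.update (trunc i y.2) i (t, 0))) < 1 := by
    intro i
    refine exists_gauge_of_metrizable
      (fun q : ((B × (ℕ → ℝ)) × (ℕ → (ℕ → ℝ) × (ℕ → ℝ))) × (ℕ → ℝ) =>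
      2 * ψ (2 * i) (q.1.1, ε.symm (Function.update (trunc i q.1.2) i (q.2, 0)))) ?_ ?_
    · refine continuous_const.mul ((hψ _).comp ((continuous_fst.comp continuous_fst).prodMk
        (ε.symm.continuous.comp ?_)))
      exact (hmod i).comp ((continuous_snd.comp continuous_fst).prodMk continuous_snd)
    · intro y
      simp only
      rw [hψ0]
      · norm_num
      · simp [ε, evenOddHomeomorph]
  choose μ hμ hμ0 hμe hμψ using hgauge
  have htr : ∀ i, Continuous fun y : (B × (ℕ → ℝ)) × (ℕ → (ℕ → ℝ) × (ℕ → ℝ)) =>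
      (y.1, trunc i y.2) := fun i =>
    continuous_fst.prodMk ((continuous_trunc i).comp continuous_snd)
  obtain ⟨H, hH, hHZ⟩ := exists_deficiency_coords (Γ' ⁻¹' Z) (fun _ _ => 0)
    (fun i n y => μ i n (y.1, trunc i y.2)) (fun _ => continuous_const)
    (fun i n => (hμ i n).comp (htr i)) (fun i n y => hμ0 i n _)
    (fun i => (hμe i).comp (htr i)) (fun _ _ _ _ _ => rfl)
    (fun i n b e e' h => by
      have : trunc i e = trunc i e' := by
        funext k
        unfold trunc
        split_ifs with hk
        · exact h k hk
        · rfl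
      simp only [this])
    (by
      rintro ⟨x, e⟩ hx i
      by_contra! hcon
      have h1 := hμψ i (x, trunc i e) (e i).1 (fun n => by simpa using hcon n)
      have h2 := hψZ (2 * i) (x, ε.symm e) hx
      rw [hψd (2 * i) x _ (ε.symm e)] at h1
      · linarith
      · intro k hk
        rcases hk.lt_or_eq with hk | rfl
        · have hk' : k / 2 < i := by omega
          simp [ε, evenOddHomeomorph, Function.update_of_ne hk'.ne, trunc, hk']
        · simp [ε, evenOddHomeomorph])
  obtain ⟨K, hK, hK0⟩ := _root_.exists_zero_coords (B := B) (R := ℕ) (Equiv.refl ℕ) le_rfl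
  refine ⟨Γ'.symm.trans (H.trans K), fun x => ?_, fun z hz => ?_⟩
  · change (K (H (Γ'.symm x))).1.1 = _
    rw [hK, hH]
    have h := hΓ (Γ.symm x)
    rw [Γ.apply_symm_apply] at h
    exact h.symm
  · exact hK0 _ (hHZ _ (by simpa using hz))

theorem FiberedZTauSet.exists_zero_coords_of_countable {A : Type u} [Countable A] [Infinite A]
    {Z : Set ((A → ℝ) × (A → ℝ))} {τ : Cardinal.{u}} (hτ : Cardinal.aleph0 ≤ τ)
    (hZ : FiberedZTauSet τ Prod.fst Z) :
    ∃ K : (A → ℝ) × (A → ℝ) ≃ₜ ((A → ℝ) × (A → ℝ)) × (A → ℝ),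
      (∀ x, (K x).1.1 = x.1) ∧ ∀ z ∈ Z, (K z).2 = 0 := by
  obtain ⟨e⟩ : Nonempty (A ≃ ℕ) := by
    obtain ⟨_⟩ := nonempty_denumerable A
    exact ⟨Denumerable.eqv A⟩
  let η := arrowHomeomorph e
  let E : (A → ℝ) × (A → ℝ) ≃ₜ (A → ℝ) × (ℕ → ℝ) := (Homeomorph.refl _).prodCongr η
  obtain ⟨K, hK, hKZ⟩ :=
    ((hZ.sepApprox hτ).image E (p' := Prod.fst) fun _ => rfl).exists_zero_coords
  refine ⟨E.trans (K.trans (((Homeomorph.refl _).prodCongr η.symm).prodCongr η.symm)),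
    fun x => hK (E x), fun z hz => ?_⟩
  change η.symm (K (E z)).2 = 0
  rw [hKZ _ (Set.mem_image_of_mem E hz)]
  rfl

/-- (Main Theorem) Fibered `Z_τ`-set unknotting in `ℝ^τ × ℝ^τ` over the first projection. -/
theorem fibered_Z_tau_unknotting
    (τ : Cardinal.{u}) (hτ : Cardinal.aleph0 ≤ τ)
    (A : Type u) (hA : Cardinal.mk A = τ)
    (Z F : Set ((A → ℝ) × (A → ℝ)))
    (hZ : FiberedZTauSet τ Prod.fst Z) (hF : FiberedZTauSet τ Prod.fst F)
    (hZC : CEmbedded Z) (hFC : CEmbedded F)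
    (h : ↥Z ≃ₜ ↥F)
    (hfib : ∀ z : Z, ((h z : (A → ℝ) × (A → ℝ))).1 = (z : (A → ℝ) × (A → ℝ)).1) :
    ∃ H : ((A → ℝ) × (A → ℝ)) ≃ₜ ((A → ℝ) × (A → ℝ)),
      (∀ z : Z, H (z : (A → ℝ) × (A → ℝ)) = (h z : (A → ℝ) × (A → ℝ))) ∧
      ∀ x, (H x).1 = x.1 := by
  subst hA
  have hK : ∀ W : Set ((A → ℝ) × (A → ℝ)), FiberedZTauSet (Cardinal.mk A) Prod.fst W →
      ∃ K : (A → ℝ) × (A → ℝ) ≃ₜ ((A → ℝ) × (A → ℝ)) × (A → ℝ),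
        (∀ x, (K x).1.1 = x.1) ∧ ∀ z ∈ W, (K z).2 = 0 := by
    intro W hW
    rcases hτ.eq_or_lt with h | h
    · have := Cardinal.infinite_iff.2 hτ
      have := Cardinal.mk_le_aleph0_iff.1 h.ge
      exact hW.exists_zero_coords_of_countable hτ
    · exact hW.exists_zero_coords_of_aleph0_lt h
  obtain ⟨K, hKp, hKZ⟩ := hK Z hZ
  obtain ⟨L, hLp, hLF⟩ := hK F hF
  exact exists_homeomorph_extension Prod.fst hZC hFC h hfib K L hKp hLp hKZ hLF
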